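/- arXiv:1911.10502 — 2 statements merged into one kernel-verified Lean document; each statement's English description precedes it below -/
import Mathlib

section
/- For every natural number k ≥ 1, every natural number c ≥ 7, and every natural number N, there exists a finite connected simple graph G with more than N vertices such that: every edge of G lies on at most one cycle of G (G is a cactus), G has exactly k cycles (exactly k distinct edge-sets of cycles), every cycle of G has length c, and G has exactly 2k good vertices. -/
open SimpleGraph

/-- The Wiener index: sum of distances over unordered pairs of vertices. -/
noncomputable def wiener {V : Type*} [Fintype V] (G : SimpleGraph V) : ℕ :=
  (∑ u : V, ∑ v : V, G.dist u v) / 2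

/-- The transmission of a vertex: sum of distances to all vertices. -/
noncomputable def transmission {V : Type*} [Fintype V] (G : SimpleGraph V) (v : V) : ℕ :=
  ∑ u : V, G.dist v u

/-- The graph `G - v`: induced subgraph on the vertices distinct from `v`. -/
def delVert {V : Type*} (G : SimpleGraph V) (v : V) : SimpleGraph {u : V // u ≠ v} :=
  SimpleGraph.comap Subtype.val G

/-- A vertex is good if `G - v` is connected and has the same Wiener index as `G`. -/
def good {V : Type*} [Fintype V] [DecidableEq V] (G : SimpleGraph V) (v : V) : Prop :=
  (delVert G v).Connected ∧ wiener (delVert G v) = wiener G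
set_option linter.unusedSectionVars false
set_option linter.unusedTactic false
set_option linter.unreachableTactic false

namespace Cac

lemma dist_lemma {V : Type*} (G : SimpleGraph V) (D : V → V → ℕ)
    (h0 : ∀ u, D u u = 0)
    (h1 : ∀ u v w, G.Adj v w → D u w ≤ D u v + 1)
    (h2 : ∀ u v, u ≠ v → ∃ w, G.Adj v w ∧ D u w + 1 ≤ D u v) :
    G.Preconnected ∧ ∀ u v, G.dist u v = D u v := by
  have key : ∀ n u v, D u v = n → ∃ p : G.Walk u v, p.length ≤ n := by
    intro n
    induction n using Nat.strong_induction_on with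
    | _ n ih =>
      intro u v h
      by_cases huv : u = v
      · subst huv
        exact ⟨.nil, by simp⟩
      · obtain ⟨w, hw, hd⟩ := h2 u v huv
        obtain ⟨p, hp⟩ := ih (D u w) (by omega) u w rfl
        refine ⟨p.concat hw.symm, ?_⟩
        rw [Walk.length_concat]
        omega
  have low : ∀ u v (p : G.Walk v u), D u v ≤ p.length := by
    intro u v p
    induction p with
    | nil => simp [h0]
    | cons h p ih =>
      rename_i a b c'
      have := h1 c' _ _ h.symm
      simp only [Walk.length_cons]
      exact this.trans (by omega)
  refine ⟨fun u v => ?_, fun u v => ?_⟩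
  · obtain ⟨p, _⟩ := key _ u v rfl
    exact ⟨p⟩
  · obtain ⟨p, hp⟩ := key _ u v rfl
    apply le_antisymm ((dist_le p).trans hp)
    obtain ⟨q, hq⟩ := (Reachable.exists_walk_length_eq_dist ⟨p⟩)
    have := low u v q.reverse
    simp at this
    omega

section
variable {B : Type} [Fintype B] [DecidableEq B] (len : B → ℕ) (cl : B → Bool)

abbrev VV := Option (Σ b, Fin (len b))

def adjF : VV len → VV len → Prop
  | none, none => False
  | none, some ⟨b, i⟩ => i.val = 0 ∨ (cl b = true ∧ i.val + 1 = len b)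
  | some ⟨b, i⟩, none => i.val = 0 ∨ (cl b = true ∧ i.val + 1 = len b)
  | some ⟨b, i⟩, some ⟨b', j⟩ => b = b' ∧ (i.val + 1 = j.val ∨ j.val + 1 = i.val)

def GG : SimpleGraph (VV len) where
  Adj := adjF len cl
  symm := ⟨by
    rintro (_ | ⟨b, i⟩) (_ | ⟨b', j⟩) h <;> simp only [adjF] at * <;> first | exact h | tauto⟩
  loopless := ⟨by
    rintro (_ | ⟨b, i⟩) h <;> simp only [adjF] at h; omega⟩

def hh (b : B) (p : ℕ) : ℕ := if cl b = true then min p (len b + 1 - p) else p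

def ad (a b : ℕ) : ℕ := a - b + (b - a)

def DD : VV len → VV len → ℕ
  | none, none => 0
  | none, some ⟨b, i⟩ => hh len cl b (i + 1)
  | some ⟨b, i⟩, none => hh len cl b (i + 1)
  | some ⟨b, i⟩, some ⟨b', j⟩ =>
      if b = b' then hh len cl b (ad i j) else hh len cl b (i + 1) + hh len cl b' (j + 1)

lemma DD_symm (x y) : DD len cl x y = DD len cl y x := by
  rcases x with (_ | ⟨b, i⟩) <;> rcases y with (_ | ⟨b', j⟩) <;> simp only [DD]
  by_cases h : b = b'
  · subst h
    simp [ad, add_comm]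
  · simp [h, Ne.symm h, add_comm]

lemma DD_self (x) : DD len cl x x = 0 := by
  rcases x with (_ | ⟨b, i⟩) <;> simp [DD, ad, hh]

lemma DD_lip (x y z) (h : (GG len cl).Adj y z) : DD len cl x z ≤ DD len cl x y + 1 := by
  change adjF len cl y z at h
  rcases x with (_ | ⟨b, i⟩) <;> rcases y with (_ | ⟨b', j⟩) <;> rcases z with (_ | ⟨b'', j'⟩) <;>
    simp only [DD, adjF, ad, hh] at *
  all_goals try have := i.2
  all_goals try have := j.2
  all_goals try have := j'.2
  · split_ifs <;> first | omega | (simp_all; done) | (simp_all; omega)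
  · split_ifs <;> first | omega | (simp_all; done) | (simp_all; omega)
  · obtain ⟨rfl, h⟩ := h
    split_ifs <;> first | omega | (simp_all; done) | (simp_all; omega)
  · by_cases e : b = b''
    · subst e
      simp only [if_true]
      split_ifs <;> first | omega | (simp_all; done) | (simp_all; omega)
    · simp only [e, if_false]; split_ifs <;> first | omega | (simp_all; done) | (simp_all; omega)
  · by_cases e : b = b'
    · subst e
      simp only [if_true]
      split_ifs <;> first | omega | (simp_all; done) | (simp_all; omega)
    · simp only [e, if_false]; split_ifs <;> first | omega | (simp_all; done) | (simp_all; omega)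
  · obtain ⟨rfl, h⟩ := h
    by_cases e : b = b'
    · subst e
      simp only [if_true]
      split_ifs <;> first | omega | (simp_all; done) | (simp_all; omega)
    · simp only [e, if_false]; split_ifs <;> first | omega | (simp_all; done) | (simp_all; omega)

lemma exists_down (b : B) (i : Fin (len b)) :
    ∃ w, (GG len cl).Adj (some ⟨b, i⟩) w ∧ ((i.val = 0 ∧ w = none) ∨
      ∃ j : Fin (len b), j.val + 1 = i.val ∧ w = some ⟨b, j⟩) := by
  by_cases h : i.val = 0
  · exact ⟨none, Or.inl h, Or.inl ⟨h, rfl⟩⟩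
  · refine ⟨some ⟨b, ⟨i.val - 1, by omega⟩⟩, ⟨rfl, ?_⟩, Or.inr ⟨_, ?_, rfl⟩⟩ <;> simp <;> omega

lemma exists_up (b : B) (i : Fin (len b)) (hb : cl b = true ∨ i.val + 1 < len b) :
    ∃ w, (GG len cl).Adj (some ⟨b, i⟩) w ∧ ((i.val + 1 = len b ∧ w = none) ∨
      ∃ j : Fin (len b), j.val = i.val + 1 ∧ w = some ⟨b, j⟩) := by
  have := i.2
  by_cases h : i.val + 1 = len b
  · refine ⟨none, Or.inr ⟨?_, h⟩, Or.inl ⟨h, rfl⟩⟩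
    rcases hb with hb | hb
    · exact hb
    · omega
  · refine ⟨some ⟨b, ⟨i.val + 1, by omega⟩⟩, ⟨rfl, ?_⟩, Or.inr ⟨_, ?_, rfl⟩⟩ <;> simp

lemma val_ne {b : B} {i j : Fin (len b)} (h : (some ⟨b, i⟩ : VV len) ≠ some ⟨b, j⟩) :
    i.val ≠ j.val := by
  intro e
  exact h (by rw [Fin.ext e])

lemma DD_desc (x y) (h : x ≠ y) : ∃ w, (GG len cl).Adj y w ∧ DD len cl x w + 1 ≤ DD len cl x y := by
  rcases y with (_ | ⟨b, i⟩)
  · rcases x with (_ | ⟨b, i⟩)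
    · exact absurd rfl h
    · have hi := i.2
      by_cases hc : cl b = true ∧ len b - i < i + 1
      · refine ⟨some ⟨b, ⟨len b - 1, by omega⟩⟩, Or.inr ⟨hc.1, ?_⟩, ?_⟩
        · simp; omega
        · simp [DD, hh, ad, hc.1]; omega
      · refine ⟨some ⟨b, ⟨0, by omega⟩⟩, Or.inl rfl, ?_⟩
        simp [DD, hh, ad]
        split_ifs with h1
        · simp [h1] at hc; omega
        · omega
  · have hi := i.2
    by_cases hx : ∃ i', x = some ⟨b, i'⟩
    · obtain ⟨i', rfl⟩ := hx
      have hi' := i'.2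
      have hne := val_ne len h
      by_cases hd : (i'.val < i.val ∧ ¬ (cl b = true ∧ len b + 1 < 2 * (i - i'))) ∨
          (i.val < i'.val ∧ (cl b = true ∧ len b + 1 < 2 * (i' - i)))
      · obtain ⟨w, hw, ⟨h0, rfl⟩ | ⟨j, hj, rfl⟩⟩ := exists_down len cl b i <;>
          refine ⟨_, hw, ?_⟩ <;> simp only [DD, hh, ad, if_true] <;> split_ifs <;>
          simp_all <;> omega
      · obtain ⟨w, hw, ⟨h0, rfl⟩ | ⟨j, hj, rfl⟩⟩ := exists_up len cl b i (by
            by_cases hb : cl b = true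
            · exact Or.inl hb
            · simp [hb] at hd; omega) <;>
          refine ⟨_, hw, ?_⟩ <;> simp only [DD, hh, ad, if_true] <;> split_ifs <;>
          simp_all <;> omega
    · have hx0 : ∀ j : Fin (len b), DD len cl x (some ⟨b, j⟩) = DD len cl x none + hh len cl b (j + 1) := by
        intro j
        rcases x with (_ | ⟨b', i'⟩)
        · simp [DD]
        · have : b' ≠ b := by rintro rfl; exact hx ⟨_, rfl⟩
          simp [DD, this]
      by_cases hc : cl b = true ∧ len b - i < i + 1
      · obtain ⟨w, hw, ⟨h0, rfl⟩ | ⟨j, hj, rfl⟩⟩ := exists_up len cl b i (Or.inl hc.1) <;>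
          refine ⟨_, hw, ?_⟩ <;> simp only [hx0, hh, hc.1, if_true] <;> omega
      · obtain ⟨w, hw, ⟨h0, rfl⟩ | ⟨j, hj, rfl⟩⟩ := exists_down len cl b i <;>
          refine ⟨_, hw, ?_⟩ <;> simp only [hx0, hh] <;> split_ifs <;> simp_all <;> omega

lemma GG_dist : (GG len cl).Preconnected ∧ ∀ u v, (GG len cl).dist u v = DD len cl u v :=
  dist_lemma _ _ (DD_self len cl) (DD_lip len cl) (DD_desc len cl)

end
end Cac

set_option linter.unusedSectionVars false
set_option linter.unusedTactic false
set_option linter.unreachableTactic false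

namespace Cac

lemma even_sum {V : Type*} [Fintype V] (D : V → V → ℕ) (h0 : ∀ x, D x x = 0)
    (hs : ∀ x y, D x y = D y x) : ∃ n, ∑ x, ∑ y, D x y = 2 * n := by
  classical
  have : ((∑ x, ∑ y, D x y : ℕ) : ZMod 2) = 0 := by
    rw [← Fintype.sum_prod_type' (f := D)]
    push_cast
    refine Finset.sum_involution (fun p _ => p.swap) ?_ ?_ ?_ ?_
    · rintro ⟨x, y⟩ _
      simp only [Prod.swap]
      rw [hs y x]
      exact CharTwo.add_self_eq_zero _
    · rintro ⟨x, y⟩ _ hne e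
      simp only [Prod.swap, Prod.mk.injEq] at e
      obtain ⟨e, -⟩ := e
      subst e
      simp [h0] at hne
    · simp
    · simp
  rw [ZMod.natCast_eq_zero_iff] at this
  exact this

lemma two_wiener {V : Type*} [Fintype V] (G : SimpleGraph V) :
    2 * wiener G = ∑ x, ∑ y, G.dist x y := by
  obtain ⟨n, hn⟩ := even_sum (fun x y => G.dist x y) (by simp) (fun x y => SimpleGraph.dist_comm)
  unfold wiener
  omega

lemma sum_split {V : Type*} [Fintype V] [DecidableEq V] (v : V) (f : V → ℕ) :
    ∑ x, f x = f v + ∑ x : {u : V // u ≠ v}, f x := by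
  rw [← Finset.add_sum_erase _ _ (Finset.mem_univ v)]
  congr 1
  exact Finset.sum_subtype _ (by simp) _

lemma wiener_del {V : Type*} [Fintype V] [DecidableEq V] (G : SimpleGraph V) (v : V)
    (D E : V → V → ℕ) (hD : ∀ x y, G.dist x y = D x y)
    (hE : ∀ x y : {u : V // u ≠ v}, (delVert G v).dist x y = D x y + E x y)
    (h1 : ∀ x, E v x = 0) (h2 : ∀ x, E x v = 0) :
    wiener (delVert G v) = wiener G ↔ ∑ x, ∑ y, E x y = 2 * ∑ x, D v x := by
  have e1 := two_wiener G
  have e2 := two_wiener (delVert G v)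
  simp only [hE, hD] at e1 e2
  simp only [Finset.sum_add_distrib] at e2
  have a1 : ∑ x, ∑ y, E x y = ∑ x : {u : V // u ≠ v}, ∑ y : {u : V // u ≠ v}, E x y := by
    rw [sum_split v]
    simp only [h1, Finset.sum_const_zero, zero_add]
    refine Finset.sum_congr rfl fun x _ => ?_
    rw [sum_split v, h2, zero_add]
  have a2 : ∑ x, ∑ y, D x y = 2 * ∑ x, D v x +
      ∑ x : {u : V // u ≠ v}, ∑ y : {u : V // u ≠ v}, D x y := by
    have z : D v v = 0 := by rw [← hD]; simp
    rw [sum_split v]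
    have : ∑ x : {u : V // u ≠ v}, ∑ y, D x y = ∑ x : {u : V // u ≠ v}, D v x +
      ∑ x : {u : V // u ≠ v}, ∑ y : {u : V // u ≠ v}, D x y := by
      rw [← Finset.sum_add_distrib]
      refine Finset.sum_congr rfl fun x _ => ?_
      rw [sum_split v, ← hD, SimpleGraph.dist_comm, hD]
    rw [this]
    have := sum_split v (D v)
    omega
  omega

section
variable {B : Type} [Fintype B] [DecidableEq B] (len : B → ℕ) (cl : B → Bool)

def PP (b0 : B) : VV len → ℕ
  | none => 0
  | some ⟨b, i⟩ => if b = b0 then i + 1 else 0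

def EE (c j a b : ℕ) : ℕ :=
  if a = j ∨ b = j then 0 else if (a < j ↔ b < j) then 2 * ad a b - c else c - 2 * ad a b

lemma EE_zero_left (c j b : ℕ) (hj : 0 < j) (hb : b ≠ j) :
    EE c j 0 b = if b < j then 2 * b - c else c - 2 * b := by
  unfold EE ad
  simp [hj, hb, hj.ne]

lemma EE_symm (c j a b : ℕ) : EE c j a b = EE c j b a := by
  unfold EE ad
  split_ifs <;> omega

def DP (b0 : B) (j0 : Fin (len b0)) (x y : VV len) : ℕ :=
  DD len cl x y + EE (len b0 + 1) (j0 + 1) (PP len b0 x) (PP len b0 y)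

variable (b0 : B) (j0 : Fin (len b0))

lemma DP_same (hcl : cl b0 = true) (i i' : Fin (len b0)) (h : i ≠ j0) (h' : i' ≠ j0) :
    DP len cl b0 j0 (some ⟨b0, i⟩) (some ⟨b0, i'⟩) =
      if (i.val < j0 ↔ i'.val < j0) then ad i i' else len b0 + 1 - ad i i' := by
  have a1 := i.2
  have a2 := i'.2
  have a3 := j0.2
  have h1 : i.val ≠ j0.val := fun e => h (Fin.ext e)
  have h2 : i'.val ≠ j0.val := fun e => h' (Fin.ext e)
  simp only [DP, DD, PP, EE, hh, hcl, if_true, ad]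
  split_ifs <;> omega

/-- height after deletion -/
def H0 (i : Fin (len b0)) : ℕ := if i.val < j0 then i + 1 else len b0 - i

lemma DP_hub (hcl : cl b0 = true) (i : Fin (len b0)) (h : i ≠ j0) :
    DP len cl b0 j0 (some ⟨b0, i⟩) none = H0 len b0 j0 i := by
  have a1 := i.2
  have a3 := j0.2
  have h1 : i.val ≠ j0.val := fun e => h (Fin.ext e)
  simp only [DP, DD, PP, if_true]
  rw [EE_symm, EE_zero_left _ _ _ (by omega) (by omega)]
  simp only [hh, hcl, if_true, H0]
  by_cases hlt : i.val < j0
  · rw [if_pos (by omega), if_pos hlt]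
    omega
  · rw [if_neg (by omega), if_neg hlt]
    omega

lemma DP_symm (x y) : DP len cl b0 j0 x y = DP len cl b0 j0 y x := by
  unfold DP
  rw [DD_symm, EE_symm]

lemma DP_out (hcl : cl b0 = true) (i : Fin (len b0)) (h : i ≠ j0) (x : VV len)
    (hx : ∀ i', x ≠ some ⟨b0, i'⟩) :
    DP len cl b0 j0 x (some ⟨b0, i⟩) = DD len cl x none + H0 len b0 j0 i := by
  have hP : PP len b0 x = PP len b0 none := by
    rcases x with (_ | ⟨b, i'⟩)
    · rfl
    · have : b ≠ b0 := by rintro rfl; exact hx _ rfl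
      simp [PP, this]
  have hD : DD len cl x (some ⟨b0, i⟩) = DD len cl x none + DD len cl none (some ⟨b0, i⟩) := by
    rcases x with (_ | ⟨b, i'⟩)
    · simp [DD]
    · have : b ≠ b0 := by rintro rfl; exact hx _ rfl
      simp [DD, this]
  have := DP_hub len cl b0 j0 hcl i h
  rw [DP_symm] at this
  unfold DP at *
  rw [hP, hD]
  omega

lemma DP_out_out (x y : VV len) (hy : ∀ i', y ≠ some ⟨b0, i'⟩)
    (hx : ∀ i', x ≠ some ⟨b0, i'⟩) :
    DP len cl b0 j0 x y = DD len cl x y := by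
  have key : ∀ x : VV len, (∀ i', x ≠ some ⟨b0, i'⟩) → PP len b0 x = 0 := by
    intro x hx
    rcases x with (_ | ⟨b, i'⟩)
    · rfl
    · have : b ≠ b0 := by rintro rfl; exact hx _ rfl
      simp [PP, this]
  unfold DP
  rw [key x hx, key y hy]
  simp [EE, ad]


lemma out_or (x : VV len) : (∃ i, x = some ⟨b0, i⟩) ∨ (∀ i', x ≠ some ⟨b0, i'⟩) := by
  by_cases h : ∃ i, x = some ⟨b0, i⟩
  · exact Or.inl h
  · exact Or.inr (fun i e => h ⟨i, e⟩)

lemma adj_out_in (y : VV len) (hy : ∀ i', y ≠ some ⟨b0, i'⟩) (i : Fin (len b0))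
    (h : (GG len cl).Adj y (some ⟨b0, i⟩)) : y = none ∧ (i.val = 0 ∨ i.val + 1 = len b0) := by
  rcases y with (_ | ⟨b, i'⟩)
  · exact ⟨rfl, h.imp id And.right⟩
  · obtain ⟨rfl, _⟩ := h
    exact absurd rfl (hy _)

lemma DP_out' (hcl : cl b0 = true) (i : Fin (len b0)) (h : i ≠ j0) (x : VV len)
    (hx : ∀ i', x ≠ some ⟨b0, i'⟩) :
    DP len cl b0 j0 (some ⟨b0, i⟩) x = DD len cl x none + H0 len b0 j0 i := by
  rw [DP_symm, DP_out len cl b0 j0 hcl i h x hx]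

lemma DP_lip (hcl : cl b0 = true) (x y z : VV len) (hx : x ≠ some ⟨b0, j0⟩)
    (hy : y ≠ some ⟨b0, j0⟩) (hz : z ≠ some ⟨b0, j0⟩) (h : (GG len cl).Adj y z) :
    DP len cl b0 j0 x z ≤ DP len cl b0 j0 x y + 1 := by
  have a3 := j0.2
  have ne : ∀ i : Fin (len b0), (some ⟨b0, i⟩ : VV len) ≠ some ⟨b0, j0⟩ → i ≠ j0 := by
    rintro i h rfl; exact h rfl
  have ne2 : ∀ i : Fin (len b0), (some ⟨b0, i⟩ : VV len) ≠ some ⟨b0, j0⟩ → i.val ≠ j0.val :=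
    fun i h e => ne i h (Fin.ext e)
  have DDn : DD len cl none none = 0 := rfl
  rcases out_or len b0 x with ⟨i, rfl⟩ | hxo
  · have a1 := i.2
    have a2 := ne2 i hx
    rcases out_or len b0 y with ⟨i1, rfl⟩ | hyo
    · have b1 := i1.2
      have b2 := ne2 i1 hy
      rcases out_or len b0 z with ⟨i2, rfl⟩ | hzo
      · have c1 := i2.2
        have c2 := ne2 i2 hz
        rw [DP_same len cl b0 j0 hcl _ _ (ne _ hx) (ne _ hz),
          DP_same len cl b0 j0 hcl _ _ (ne _ hx) (ne _ hy)]
        have := h.2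
        unfold ad
        split_ifs <;> omega
      · obtain ⟨rfl, h'⟩ := adj_out_in len cl b0 z hzo i1 h.symm
        rw [DP_hub len cl b0 j0 hcl _ (ne _ hx),
          DP_same len cl b0 j0 hcl _ _ (ne _ hx) (ne _ hy)]
        unfold H0 ad
        split_ifs <;> omega
    · rcases out_or len b0 z with ⟨i2, rfl⟩ | hzo
      · have c1 := i2.2
        have c2 := ne2 i2 hz
        obtain ⟨rfl, h'⟩ := adj_out_in len cl b0 y hyo i2 h
        rw [DP_hub len cl b0 j0 hcl _ (ne _ hx),
          DP_same len cl b0 j0 hcl _ _ (ne _ hx) (ne _ hz)]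
        unfold H0 ad
        split_ifs <;> omega
      · rw [DP_out' len cl b0 j0 hcl _ (ne _ hx) _ hyo, DP_out' len cl b0 j0 hcl _ (ne _ hx) _ hzo]
        have := DD_lip len cl none y z h
        rw [DD_symm len cl _ y, DD_symm len cl _ z] at this
        omega
  · rcases out_or len b0 y with ⟨i1, rfl⟩ | hyo
    · have b1 := i1.2
      have b2 := ne2 i1 hy
      rw [DP_out len cl b0 j0 hcl _ (ne _ hy) _ hxo]
      rcases out_or len b0 z with ⟨i2, rfl⟩ | hzo
      · have c1 := i2.2
        have c2 := ne2 i2 hz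
        rw [DP_out len cl b0 j0 hcl _ (ne _ hz) _ hxo]
        have := h.2
        unfold H0
        split_ifs <;> omega
      · obtain ⟨rfl, h'⟩ := adj_out_in len cl b0 z hzo i1 h.symm
        rw [DP_out_out len cl b0 j0 _ _ hzo hxo]
        omega
    · rw [DP_out_out len cl b0 j0 _ _ hyo hxo]
      rcases out_or len b0 z with ⟨i2, rfl⟩ | hzo
      · have c1 := i2.2
        have c2 := ne2 i2 hz
        obtain ⟨rfl, h'⟩ := adj_out_in len cl b0 y hyo i2 h
        rw [DP_out len cl b0 j0 hcl _ (ne _ hz) _ hxo]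
        unfold H0
        split_ifs <;> omega
      · rw [DP_out_out len cl b0 j0 _ _ hzo hxo]
        exact DD_lip len cl _ _ _ h

lemma DP_desc (hcl : cl b0 = true) (x y : VV len) (hx : x ≠ some ⟨b0, j0⟩)
    (hy : y ≠ some ⟨b0, j0⟩) (hxy : x ≠ y) :
    ∃ w, w ≠ some ⟨b0, j0⟩ ∧ (GG len cl).Adj y w ∧
      DP len cl b0 j0 x w + 1 ≤ DP len cl b0 j0 x y := by
  have a3 := j0.2
  have ne : ∀ i : Fin (len b0), (some ⟨b0, i⟩ : VV len) ≠ some ⟨b0, j0⟩ → i ≠ j0 := by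
    rintro i h rfl; exact h rfl
  have ne2 : ∀ i : Fin (len b0), (some ⟨b0, i⟩ : VV len) ≠ some ⟨b0, j0⟩ → i.val ≠ j0.val :=
    fun i h e => ne i h (Fin.ext e)
  have ne3 : ∀ i : Fin (len b0), i.val ≠ j0.val → (some ⟨b0, i⟩ : VV len) ≠ some ⟨b0, j0⟩ := by
    rintro i h e
    simp only [Option.some.injEq, Sigma.mk.injEq, heq_eq_eq, true_and] at e
    exact h (by rw [e])
  have ne4 : ∀ i : Fin (len b0), i.val ≠ j0.val → i ≠ j0 := fun i h e => h (by rw [e])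
  have no : ∀ i', (none : VV len) ≠ some ⟨b0, i'⟩ := by simp
  have DDn : DD len cl none none = 0 := rfl
  rcases out_or len b0 y with ⟨i1, rfl⟩ | hyo
  · have b1 := i1.2
    have b2 := ne2 i1 hy
    by_cases hs : ∃ i, x = some ⟨b0, i⟩ ∧ (i.val < j0 ↔ i1.val < j0)
    · obtain ⟨i, rfl, hs⟩ := hs
      have a1 := i.2
      have a2 := ne2 i hx
      have a4 := val_ne len hxy
      by_cases hlt : i.val < i1
      · obtain ⟨w, hw, ⟨h0, rfl⟩ | ⟨j, hj, rfl⟩⟩ := exists_down len cl b0 i1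
        · omega
        · refine ⟨_, ne3 j (by omega), hw, ?_⟩
          rw [DP_same len cl b0 j0 hcl _ _ (ne _ hx) (ne4 _ (by omega)),
            DP_same len cl b0 j0 hcl _ _ (ne _ hx) (ne _ hy)]
          unfold ad
          split_ifs <;> omega
      · obtain ⟨w, hw, ⟨h0, rfl⟩ | ⟨j, hj, rfl⟩⟩ := exists_up len cl b0 i1 (Or.inl hcl)
        · omega
        · refine ⟨_, ne3 j (by omega), hw, ?_⟩
          rw [DP_same len cl b0 j0 hcl _ _ (ne _ hx) (ne4 _ (by omega)),
            DP_same len cl b0 j0 hcl _ _ (ne _ hx) (ne _ hy)]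
          unfold ad
          split_ifs <;> omega
    · have key : ∃ C, DP len cl b0 j0 x none = C ∧
          ∀ j : Fin (len b0), j.val ≠ j0.val → (j.val < j0 ↔ i1.val < j0) →
          DP len cl b0 j0 x (some ⟨b0, j⟩) = C + H0 len b0 j0 j := by
        rcases out_or len b0 x with ⟨i, rfl⟩ | hxo
        · have a1 := i.2
          have a2 := ne2 i hx
          have hs' : ¬ (i.val < j0 ↔ i1.val < j0) := fun h => hs ⟨i, rfl, h⟩
          refine ⟨_, DP_hub len cl b0 j0 hcl _ (ne _ hx), fun j hj hj1 => ?_⟩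
          have := j.2
          rw [DP_same len cl b0 j0 hcl _ _ (ne _ hx) (ne4 _ hj)]
          unfold ad H0
          split_ifs <;> omega
        · refine ⟨_, DP_out_out len cl b0 j0 _ _ no hxo, fun j hj hj1 => ?_⟩
          rw [DP_out len cl b0 j0 hcl _ (ne4 _ hj) _ hxo]
      obtain ⟨C, hC, hC1⟩ := key
      rw [hC1 i1 b2 Iff.rfl]
      by_cases hlt : i1.val < j0
      · obtain ⟨w, hw, ⟨h0, rfl⟩ | ⟨j, hj, rfl⟩⟩ := exists_down len cl b0 i1
        · refine ⟨_, no j0, hw, ?_⟩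
          rw [hC]
          unfold H0
          split_ifs; omega
        · refine ⟨_, ne3 j (by omega), hw, ?_⟩
          rw [hC1 j (by omega) (by omega)]
          unfold H0
          split_ifs <;> omega
      · obtain ⟨w, hw, ⟨h0, rfl⟩ | ⟨j, hj, rfl⟩⟩ := exists_up len cl b0 i1 (Or.inl hcl)
        · refine ⟨_, no j0, hw, ?_⟩
          rw [hC]
          unfold H0
          split_ifs; omega
        · have := j.2
          refine ⟨_, ne3 j (by omega), hw, ?_⟩
          rw [hC1 j (by omega) (by omega)]
          unfold H0
          split_ifs <;> omega
  · rcases out_or len b0 x with ⟨i, rfl⟩ | hxo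
    · have a1 := i.2
      have a2 := ne2 i hx
      rw [DP_out' len cl b0 j0 hcl _ (ne _ hx) _ hyo]
      by_cases hyn : y = none
      · subst hyn
        by_cases hlt : i.val < j0
        · refine ⟨some ⟨b0, ⟨0, by omega⟩⟩, ne3 _ (by simp; omega), Or.inl rfl, ?_⟩
          rw [DP_same len cl b0 j0 hcl _ _ (ne _ hx) (ne4 _ (by simp; omega))]
          simp only [ad, H0]
          split_ifs <;> omega
        · refine ⟨some ⟨b0, ⟨len b0 - 1, by omega⟩⟩, ne3 _ (by simp; omega),
            Or.inr ⟨hcl, by simp; omega⟩, ?_⟩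
          rw [DP_same len cl b0 j0 hcl _ _ (ne _ hx) (ne4 _ (by simp; omega))]
          simp only [ad, H0]
          split_ifs <;> omega
      · obtain ⟨w, hw, hd⟩ := DD_desc len cl none y (Ne.symm hyn)
        have hwo : ∀ i', w ≠ some ⟨b0, i'⟩ := by
          rintro i' rfl
          exact hyn (adj_out_in len cl b0 y hyo i' hw).1
        refine ⟨w, hwo j0, hw, ?_⟩
        rw [DP_out' len cl b0 j0 hcl _ (ne _ hx) _ hwo]
        rw [DD_symm len cl _ y, DD_symm len cl _ w] at hd
        omega
    · obtain ⟨w, hw, hd⟩ := DD_desc len cl x y hxy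
      have hwo : ∀ i', w ≠ some ⟨b0, i'⟩ := by
        rintro i' rfl
        obtain ⟨rfl, -⟩ := adj_out_in len cl b0 y hyo i' hw
        have : DD len cl x none ≤ DD len cl x (some ⟨b0, i'⟩) := by
          rcases x with (_ | ⟨b, i⟩)
          · simp [DD]
          · have : b ≠ b0 := by rintro rfl; exact hxo _ rfl
            simp [DD, this]
        omega
      refine ⟨w, hwo j0, hw, ?_⟩
      rw [DP_out_out len cl b0 j0 _ _ hyo hxo, DP_out_out len cl b0 j0 _ _ hwo hxo]
      exact hd

lemma DP_self (x : VV len) : DP len cl b0 j0 x x = 0 := by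
  unfold DP EE ad
  rw [DD_self]
  simp

lemma del_dist (hcl : cl b0 = true) :
    (delVert (GG len cl) (some ⟨b0, j0⟩)).Preconnected ∧
    ∀ x y : {u : VV len // u ≠ some ⟨b0, j0⟩},
      (delVert (GG len cl) (some ⟨b0, j0⟩)).dist x y = DP len cl b0 j0 x y := by
  refine dist_lemma _ (fun x y : {u : VV len // u ≠ some ⟨b0, j0⟩} => DP len cl b0 j0 x.1 y.1)
    ?_ ?_ ?_
  · exact fun x => DP_self len cl b0 j0 _
  · exact fun x y z h => DP_lip len cl b0 j0 hcl _ _ _ x.2 y.2 z.2 h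
  · intro x y h
    obtain ⟨w, h1, h2, h3⟩ := DP_desc len cl b0 j0 hcl x.1 y.1 x.2 y.2 (fun e => h (Subtype.ext e))
    exact ⟨⟨w, h1⟩, h2, h3⟩

lemma good_closed (hcl : cl b0 = true) : good (GG len cl) (some ⟨b0, j0⟩) ↔
    ∑ x, ∑ y, EE (len b0 + 1) (j0 + 1) (PP len b0 x) (PP len b0 y) =
      2 * ∑ x, DD len cl (some ⟨b0, j0⟩) x := by
  have h := del_dist len cl b0 j0 hcl
  have hne : Nonempty {u : VV len // u ≠ some ⟨b0, j0⟩} := ⟨⟨none, by simp⟩⟩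
  have hc : (delVert (GG len cl) (some ⟨b0, j0⟩)).Connected := ⟨h.1⟩
  unfold good
  rw [and_iff_right hc]
  apply wiener_del _ _ (DD len cl)
    (fun x y => EE (len b0 + 1) (j0 + 1) (PP len b0 x) (PP len b0 y)) (GG_dist len cl).2
  · exact h.2
  · intro x; simp [PP, EE]
  · intro x; simp [PP, EE]

lemma sum_PP (f : ℕ → ℕ) : ∑ x, f (PP len b0 x) =
    (1 + ∑ b ∈ Finset.univ.erase b0, len b) * f 0 + ∑ i ∈ Finset.range (len b0), f (i + 1) := by
  rw [Fintype.sum_option, Fintype.sum_sigma, ← Finset.add_sum_erase _ _ (Finset.mem_univ b0)]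
  have : ∀ b ∈ Finset.univ.erase b0, ∑ y, f (PP len b0 (some ⟨b, y⟩)) = len b * f 0 := by
    intro b hb
    have := Finset.ne_of_mem_erase hb
    simp [PP, this]
  rw [Finset.sum_congr rfl this, ← Finset.sum_mul]
  simp only [PP, if_true]
  rw [Fin.sum_univ_eq_sum_range (fun i => f (i + 1))]
  ring

def Acon (c j : ℕ) : ℕ := ∑ a ∈ Finset.range (c - 1), ∑ b ∈ Finset.range (c - 1), EE c j (a + 1) (b + 1)
def Scon (c j : ℕ) : ℕ := ∑ b ∈ Finset.range (c - 1), EE c j 0 (b + 1)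
def cy (c d : ℕ) : ℕ := min d (c - d)
def Kcon (c j : ℕ) : ℕ := cy c j + ∑ b ∈ Finset.range (c - 1), cy c (ad j (b + 1))

lemma good_closed' (c : ℕ) (hcl : cl b0 = true) (hc : len b0 + 1 = c) (M τ : ℕ)
    (hM : ∑ b ∈ Finset.univ.erase b0, len b = M)
    (hτ : ∑ b ∈ Finset.univ.erase b0, ∑ i ∈ Finset.range (len b), hh len cl b (i + 1) = τ) :
    good (GG len cl) (some ⟨b0, j0⟩) ↔
    2 * ((1 + M) * Scon c (j0 + 1)) + Acon c (j0 + 1) =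
      2 * (Kcon c (j0 + 1) + M * cy c (j0 + 1) + τ) := by
  subst hc
  rw [good_closed len cl b0 j0 hcl]
  have e1 : ∑ x, ∑ y, EE (len b0 + 1) (j0 + 1) (PP len b0 x) (PP len b0 y) =
      2 * ((1 + M) * Scon (len b0 + 1) (j0 + 1)) + Acon (len b0 + 1) (j0 + 1) := by
    have : ∀ x, ∑ y, EE (len b0 + 1) (j0 + 1) (PP len b0 x) (PP len b0 y) =
        (fun p => (1 + M) * EE (len b0 + 1) (j0 + 1) p 0 +
          ∑ i ∈ Finset.range (len b0), EE (len b0 + 1) (j0 + 1) p (i + 1)) (PP len b0 x) := by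
      intro x
      rw [sum_PP len b0 (fun p => EE (len b0 + 1) (j0 + 1) (PP len b0 x) p), hM]
    rw [Finset.sum_congr rfl (fun x _ => this x), sum_PP len b0 (fun p => (1 + M) * EE (len b0 + 1) (j0 + 1) p 0 +
          ∑ i ∈ Finset.range (len b0), EE (len b0 + 1) (j0 + 1) p (i + 1)), hM]
    simp only [Finset.sum_add_distrib]
    rw [← Finset.mul_sum]
    simp only [EE_symm _ _ (_ + 1) 0]
    have z : EE (len b0 + 1) (j0 + 1) 0 0 = 0 := by simp [EE, ad]
    rw [z]
    simp only [Acon, Scon, Nat.add_sub_cancel]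
    ring
  have e2 : ∑ x, DD len cl (some ⟨b0, j0⟩) x = 
      Kcon (len b0 + 1) (j0 + 1) + M * cy (len b0 + 1) (j0 + 1) + τ := by
    rw [Fintype.sum_option, Fintype.sum_sigma, ← Finset.add_sum_erase _ _ (Finset.mem_univ b0)]
    have : ∀ b ∈ Finset.univ.erase b0, ∑ y, DD len cl (some ⟨b0, j0⟩) (some ⟨b, y⟩) =
        len b * cy (len b0 + 1) (j0 + 1) + ∑ i ∈ Finset.range (len b), hh len cl b (i + 1) := by
      intro b hb
      have := (Finset.ne_of_mem_erase hb).symm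
      simp only [DD, this, if_false, Finset.sum_add_distrib]
      rw [Fin.sum_univ_eq_sum_range (fun i => hh len cl b (i + 1))]
      simp [hh, hcl, cy]
    rw [Finset.sum_congr rfl this, Finset.sum_add_distrib, ← Finset.sum_mul, hM, hτ]
    simp only [DD, if_true, hh, hcl, Kcon, cy, Nat.add_sub_cancel]
    rw [Fin.sum_univ_eq_sum_range (fun i => min (ad j0 i) (len b0 + 1 - ad j0 i))]
    simp only [ad, Nat.add_sub_add_right]
    ring
  rw [e1, e2]

end
end Cac

set_option linter.unusedSectionVars false
set_option linter.unusedTactic false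
set_option linter.unreachableTactic false

namespace Cac

lemma sep {V : Type*} (G : SimpleGraph V) (P : V → Prop) (h : ∀ x y, G.Adj x y → P x → P y)
    (x y : V) (hr : G.Reachable x y) (hx : P x) : P y := by
  obtain ⟨p⟩ := hr
  induction p with
  | nil => exact hx
  | cons a p ih => exact ih (h _ _ a hx)

section
variable {B : Type} [Fintype B] [DecidableEq B] (len : B → ℕ) (cl : B → Bool)

lemma not_good_hub (hl : ∀ b, 1 ≤ len b) (b1 b2 : B) (hb : b1 ≠ b2) :
    ¬ good (GG len cl) none := by
  rintro ⟨hc, -⟩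
  have h1 := hl b1
  have h2 := hl b2
  have := sep _ (fun x => ∃ i, x.1 = some ⟨b1, i⟩) ?_ ⟨some ⟨b1, ⟨0, h1⟩⟩, by simp⟩
    ⟨some ⟨b2, ⟨0, h2⟩⟩, by simp⟩ (hc.preconnected _ _) ⟨_, rfl⟩
  · obtain ⟨i, hi⟩ := this
    simp only [Option.some.injEq, Sigma.mk.injEq] at hi
    exact hb hi.1.symm
  · rintro ⟨x, hx⟩ ⟨y, hy⟩ h ⟨i, hi⟩
    simp only at hi
    subst hi
    rcases y with (_ | ⟨b, j⟩)
    · exact absurd rfl hy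
    · obtain ⟨rfl, -⟩ := (show adjF len cl (some ⟨b1, i⟩) (some ⟨b, j⟩) from h)
      exact ⟨_, rfl⟩

lemma not_good_inner (b : B) (j0 : Fin (len b)) (hb : cl b = false) (hj : j0.val + 1 < len b) :
    ¬ good (GG len cl) (some ⟨b, j0⟩) := by
  rintro ⟨hc, -⟩
  have := sep _ (fun x => ∃ i : Fin (len b), j0.val < i.val ∧ x.1 = some ⟨b, i⟩) ?_
    ⟨some ⟨b, ⟨j0.val + 1, hj⟩⟩, by
      simp only [ne_eq, Option.some.injEq, Sigma.mk.injEq, heq_eq_eq, true_and, Fin.ext_iff]; omega⟩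
    ⟨none, by simp⟩ (hc.preconnected _ _) ⟨_, by simp, rfl⟩
  · obtain ⟨i, -, hi⟩ := this
    simp at hi
  · rintro ⟨x, hx⟩ ⟨y, hy⟩ h ⟨i, hi0, hi⟩
    simp only at hi
    subst hi
    have h' : adjF len cl _ _ := h
    rcases y with (_ | ⟨b', j⟩)
    · simp [adjF, hb] at h'
      omega
    · obtain ⟨rfl, h'⟩ := h'
      have := val_ne len hy
      exact ⟨j, by omega, rfl⟩

lemma not_good_last (b : B) (j0 : Fin (len b)) (hb : cl b = false) (hj : j0.val + 1 = len b) :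
    ¬ good (GG len cl) (some ⟨b, j0⟩) := by
  rintro ⟨-, hw⟩
  have h : (delVert (GG len cl) (some ⟨b, j0⟩)).Preconnected ∧
    ∀ x y : {u : VV len // u ≠ some ⟨b, j0⟩},
      (delVert (GG len cl) (some ⟨b, j0⟩)).dist x y = DD len cl x y := by
    refine dist_lemma _ (fun x y : {u : VV len // u ≠ some ⟨b, j0⟩} => DD len cl x.1 y.1) ?_ ?_ ?_
    · exact fun x => DD_self len cl _
    · exact fun x y z h => DD_lip len cl _ _ _ h
    · rintro ⟨x, hx⟩ ⟨y, hy⟩ hxy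
      obtain ⟨w, h1, h2⟩ := DD_desc len cl x y (fun e => hxy (Subtype.ext e))
      refine ⟨⟨w, ?_⟩, h1, h2⟩
      rintro rfl
      have h1' : adjF len cl _ _ := h1
      rcases y with (_ | ⟨b', j⟩)
      · simp [adjF, hb] at h1'
        rcases x with (_ | ⟨b'', i⟩)
        · simp [DD] at h2
        · by_cases e : b'' = b
          · subst e
            have := i.2
            have := val_ne len hx
            omega
          · simp [DD, e] at h2
      · obtain ⟨rfl, h1'⟩ := h1'
        rcases x with (_ | ⟨b'', i⟩)
        · simp [DD, hh, hb] at h2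
          omega
        · by_cases e : b'' = b'
          · subst e
            have := i.2
            have := val_ne len hx
            have := j.2
            simp [DD, hh, hb, ad] at h2
            omega
          · have := j.2
            simp [DD, e, hh, hb] at h2
            omega
  rw [wiener_del _ _ (DD len cl) (fun _ _ => 0) (GG_dist len cl).2 h.2 (by simp) (by simp)] at hw
  rw [Fintype.sum_option] at hw
  simp [DD, hh, hb] at hw

/-- vertex at position n on branch b -/
def vt (b : B) (n : ℕ) : VV len :=
  if h : 0 < n ∧ n ≤ len b then some ⟨b, ⟨n - 1, by omega⟩⟩ else none

lemma vt_some (b : B) (i : Fin (len b)) : vt len b (i + 1) = some ⟨b, i⟩ := by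
  have := i.2
  unfold vt
  rw [dif_pos (by omega)]
  simp

lemma adj_vt (b : B) (i : Fin (len b)) (y) (h : (GG len cl).Adj (some ⟨b, i⟩) y) :
    y = vt len b i ∨ ((cl b = true ∨ i.val + 1 < len b) ∧ y = vt len b (i + 2)) := by
  have hi := i.2
  have h' : adjF len cl _ _ := h
  rcases y with (_ | ⟨b', j⟩)
  · rcases h' with h' | ⟨h1, h2⟩
    · left; simp [vt, h']
    · right
      refine ⟨Or.inl h1, ?_⟩
      unfold vt
      rw [dif_neg (by omega)]
  · obtain ⟨rfl, h'⟩ := h'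
    have hj := j.2
    rw [← vt_some]
    rcases h' with h' | h'
    · right
      rw [← h']
      exact ⟨Or.inr (by omega), rfl⟩
    · left
      rw [h']

lemma cyc_nbr {b : B} {i : Fin (len b)} {u : VV len} (w : (GG len cl).Walk u u) (hw : w.IsCycle)
    (hs : some ⟨b, i⟩ ∈ w.support) :
    (cl b = true ∨ i.val + 1 < len b) ∧ w.toSubgraph.Adj (some ⟨b, i⟩) (vt len b i) ∧
      w.toSubgraph.Adj (some ⟨b, i⟩) (vt len b (i + 2)) := by
  have h2 := hw.ncard_neighborSet_toSubgraph_eq_two hs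
  have hsub : w.toSubgraph.neighborSet (some ⟨b, i⟩) ⊆ {y | y = vt len b i ∨
      ((cl b = true ∨ i.val + 1 < len b) ∧ y = vt len b (i + 2))} := by
    intro y hy
    exact adj_vt len cl b i y (w.toSubgraph.adj_sub hy)
  by_cases hc : cl b = true ∨ i.val + 1 < len b
  · refine ⟨hc, ?_⟩
    have hsub' : w.toSubgraph.neighborSet (some ⟨b, i⟩) ⊆ {vt len b i, vt len b (i + 2)} := by
      intro y hy
      rcases hsub hy with h | h
      · exact Or.inl h
      · exact Or.inr h.2
    have he := Set.eq_of_subset_of_ncard_le hsub' (by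
      rw [h2]; exact (Set.ncard_insert_le _ _).trans (by simp)) (Set.toFinite _)
    constructor
    · change vt len b i ∈ w.toSubgraph.neighborSet (some ⟨b, i⟩)
      rw [he]; simp
    · change vt len b (i + 2) ∈ w.toSubgraph.neighborSet (some ⟨b, i⟩)
      rw [he]; simp
  · exfalso
    have hsub' : w.toSubgraph.neighborSet (some ⟨b, i⟩) ⊆ {vt len b i} := by
      intro y hy
      rcases hsub hy with h | h
      · exact h
      · exact absurd h.1 hc
    have := Set.ncard_le_ncard hsub' (Set.toFinite _)
    rw [h2] at this
    simp at this

lemma supp_of_adj {u x y : VV len} (w : (GG len cl).Walk u u) (h : w.toSubgraph.Adj x y) :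
    x ∈ w.support := by
  rw [← Walk.mem_verts_toSubgraph]
  exact w.toSubgraph.edge_vert h

lemma cyc_all {b : B} {i : Fin (len b)} {u : VV len} (w : (GG len cl).Walk u u) (hw : w.IsCycle)
    (hs : some ⟨b, i⟩ ∈ w.support) : ∀ j : Fin (len b), some ⟨b, j⟩ ∈ w.support := by
  have up : ∀ n, ∀ j : Fin (len b), j.val = i.val + n → some ⟨b, j⟩ ∈ w.support := by
    intro n
    induction n with
    | zero => intro j hj; rw [show j = i from Fin.ext hj]; exact hs
    | succ n ih =>
      intro j hj
      have hj2 := j.2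
      have h1 := (cyc_nbr len cl w hw (ih ⟨i + n, by omega⟩ rfl)).2.2
      simp only at h1
      rw [show i.val + n + 2 = j.val + 1 by omega, vt_some] at h1
      exact supp_of_adj len cl w h1.symm
  have down : ∀ n, ∀ j : Fin (len b), j.val + n = i.val → some ⟨b, j⟩ ∈ w.support := by
    intro n
    induction n with
    | zero => intro j hj; rw [show j = i from Fin.ext hj]; exact hs
    | succ n ih =>
      intro j hj
      have hi2 := i.2
      have h1 := (cyc_nbr len cl w hw (ih ⟨j + 1, by omega⟩ (by simp; omega))).2.1
      simp only at h1
      rw [vt_some] at h1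
      exact supp_of_adj len cl w h1.symm
  intro j
  rcases le_total j.val i.val with h | h
  · exact down (i - j) j (by omega)
  · exact up (j - i) j (by omega)

def Cset (b : B) : Set (Sym2 (VV len)) :=
  {e | e ∈ (GG len cl).edgeSet ∧ ∃ i, some ⟨b, i⟩ ∈ e}

lemma cyc_branch {b : B} {i : Fin (len b)} {u : VV len} (w : (GG len cl).Walk u u) (hw : w.IsCycle)
    (hs : some ⟨b, i⟩ ∈ w.support) (hb2 : cl b = true → 2 ≤ len b) : cl b = true ∧
    w.toSubgraph.neighborSet none = {vt len b 1, vt len b (len b)} := by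
  have hi := i.2
  have hlast := cyc_nbr len cl w hw (cyc_all len cl w hw hs ⟨len b - 1, by omega⟩)
  have hfirst := cyc_nbr len cl w hw (cyc_all len cl w hw hs ⟨0, by omega⟩)
  have hc : cl b = true := by
    rcases hlast.1 with h | h
    · exact h
    · simp at h; omega
  refine ⟨hc, ?_⟩
  have hl2 := hb2 hc
  have h1 := hfirst.2.1
  have h2 := hlast.2.2
  rw [← vt_some] at h1 h2
  simp only at h1 h2
  rw [show len b - 1 + 1 = len b by omega, show len b - 1 + 2 = len b + 1 by omega] at h2
  have e0 : vt len b 0 = none := by simp [vt]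
  have e1 : vt len b (len b + 1) = none := by simp [vt]
  rw [e0] at h1
  rw [e1] at h2
  have hn := hw.ncard_neighborSet_toSubgraph_eq_two (supp_of_adj len cl w h1.symm)
  symm
  apply Set.eq_of_subset_of_ncard_le _ _ (Set.toFinite _)
  · rintro y (rfl | rfl)
    · exact h1.symm
    · exact h2.symm
  · rw [hn, Set.ncard_pair]
    unfold vt
    rw [dif_pos (by omega), dif_pos (by omega)]
    simp only [ne_eq, Option.some.injEq, Sigma.mk.injEq, heq_eq_eq, true_and, Fin.ext_iff]
    omega

lemma cyc_struct {u : VV len} (w : (GG len cl).Walk u u) (hw : w.IsCycle)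
    (hb2 : ∀ b, cl b = true → 2 ≤ len b) :
    ∃ b, cl b = true ∧ {e | e ∈ w.edges} = Cset len cl b ∧ w.length = len b + 1 := by
  have hex : ∃ b i, some ⟨b, i⟩ ∈ w.support := by
    by_contra! hno
    have hu : u = none := by
      rcases u with (_ | ⟨b, i⟩)
      · rfl
      · exact absurd w.start_mem_support (hno b i)
    have h2 := hw.ncard_neighborSet_toSubgraph_eq_two w.start_mem_support
    have : (w.toSubgraph.neighborSet u).Nonempty := by
      rw [← Set.ncard_pos]; omega
    obtain ⟨y, hy⟩ := this
    rcases y with (_ | ⟨b, i⟩)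
    · subst hu
      exact (w.toSubgraph.adj_sub hy).ne rfl
    · exact hno b i (supp_of_adj len cl w (Subgraph.Adj.symm hy))
  obtain ⟨b, i, hs⟩ := hex
  obtain ⟨hc, hn⟩ := cyc_branch len cl w hw hs (hb2 b)
  have hl := hb2 b hc
  have uniq : ∀ b' i', some ⟨b', i'⟩ ∈ w.support → b' = b := by
    intro b' i' hs'
    obtain ⟨hc', hn'⟩ := cyc_branch len cl w hw hs' (hb2 b')
    have hl' := hb2 b' hc'
    have : vt len b' 1 ∈ ({vt len b 1, vt len b (len b)} : Set (VV len)) := by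
      rw [← hn, hn']; simp
    simp only [vt, Set.mem_insert_iff, Set.mem_singleton_iff] at this
    rw [dif_pos (by omega), dif_pos (by omega), dif_pos (by omega)] at this
    simp only [Option.some.injEq, Sigma.mk.injEq] at this
    tauto
  have hall := cyc_all len cl w hw hs
  have hnone : none ∈ w.support := by
    have : vt len b 1 ∈ w.toSubgraph.neighborSet none := by rw [hn]; simp
    exact supp_of_adj len cl w this
  refine ⟨b, hc, ?_, ?_⟩
  · ext e
    induction e with
    | _ x y =>
    simp only [Set.mem_ofPred_eq, Cset]
    have key : ∀ j y, (GG len cl).Adj (some ⟨b, j⟩) y → s(some ⟨b, j⟩, y) ∈ w.edges := by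
      intro j y h
      have := cyc_nbr len cl w hw (hall j)
      rw [← Walk.adj_toSubgraph_iff_mem_edges]
      rcases adj_vt len cl b j y h with rfl | ⟨-, rfl⟩
      · exact this.2.1
      · exact this.2.2
    constructor
    · intro he
      have hadj := w.adj_of_mem_edges he
      refine ⟨hadj, ?_⟩
      rcases x with (_ | ⟨b', j⟩)
      · rcases y with (_ | ⟨b', j⟩)
        · exact absurd rfl hadj.ne
        · have := uniq b' j (w.snd_mem_support_of_mem_edges he)
          subst this
          exact ⟨j, by simp⟩
      · have := uniq b' j (w.fst_mem_support_of_mem_edges he)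
        subst this
        exact ⟨j, by simp⟩
    · rintro ⟨hadj, j, hj⟩
      rw [Sym2.mem_iff] at hj
      rcases hj with rfl | rfl
      · exact key j y hadj
      · rw [Sym2.eq_swap]
        exact key j x hadj.symm
  · have hsup : w.support.tail.toFinset = Finset.insertNone
        ((Finset.univ : Finset (Fin (len b))).map ⟨Sigma.mk b, sigma_mk_injective⟩) := by
      have hst : ∀ x, x ∈ w.support.tail ↔ x ∈ w.support := by
        intro x
        constructor
        · exact List.mem_of_mem_tail
        · intro h
          rw [Walk.mem_support_iff] at h
          rcases h with rfl | h
          · exact Walk.end_mem_tail_support hw.not_nil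
          · exact h
      ext x
      rw [List.mem_toFinset, hst]
      rcases x with (_ | ⟨b', j⟩)
      · simp [hnone]
      · simp only [Finset.some_mem_insertNone, Finset.mem_map, Finset.mem_univ, true_and,
          Function.Embedding.coeFn_mk, Sigma.mk.injEq]
        constructor
        · intro h
          have := uniq b' j h
          subst this
          exact ⟨j, rfl, HEq.rfl⟩
        · rintro ⟨a, rfl, h⟩
          exact hall _
    have := List.toFinset_card_of_nodup hw.support_nodup
    rw [hsup] at this
    simp at this
    omega

lemma cyc_exists (b : B) (hc : cl b = true) (hl : 2 ≤ len b) :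
    ∃ (u : VV len) (w : (GG len cl).Walk u u), w.IsCycle ∧
      s(none, some ⟨b, ⟨0, by omega⟩⟩) ∈ w.edges := by
  have hadj : (GG len cl).Adj none (some ⟨b, ⟨0, by omega⟩⟩) := Or.inl rfl
  by_contra! hno
  have hbr : (GG len cl).IsBridge s(none, some ⟨b, ⟨0, by omega⟩⟩) := by
    rw [isBridge_iff_forall_cycle_notMem hadj]
    exact fun u w hw => hno u w hw
  rw [isBridge_iff] at hbr
  apply hbr
  have up : ∀ n (hn : n < len b), ((GG len cl).deleteEdges
      {s(none, some ⟨b, ⟨0, by omega⟩⟩)}).Reachable (some ⟨b, ⟨0, by omega⟩⟩) (some ⟨b, ⟨n, hn⟩⟩) := by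
    intro n
    induction n with
    | zero => intro hn; exact Reachable.refl _
    | succ n ih =>
      intro hn
      refine (ih (by omega)).trans (Adj.reachable ?_)
      rw [deleteEdges_adj]
      refine ⟨⟨rfl, Or.inl rfl⟩, ?_⟩
      simp
  refine Reachable.symm ((up (len b - 1) (by omega)).trans (Adj.reachable ?_))
  rw [deleteEdges_adj]
  refine ⟨Or.inr ⟨hc, by simp; omega⟩, ?_⟩
  simp
  omega

lemma Cset_first (b b' : B) (hl : 1 ≤ len b)
    (h : s(none, some ⟨b, ⟨0, hl⟩⟩) ∈ Cset len cl b') : b = b' := by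
  obtain ⟨-, i, hi⟩ := h
  simp only [Sym2.mem_iff, Option.some.injEq, Sigma.mk.injEq] at hi
  rcases hi with hi | hi
  · simp at hi
  · exact hi.1.symm

lemma cactus_part (c : ℕ) (hb2 : ∀ b, cl b = true → len b + 1 = c) (hc3 : 3 ≤ c) :
    (∀ (u₁ : VV len) (w₁ : (GG len cl).Walk u₁ u₁), w₁.IsCycle →
        ∀ (u₂ : VV len) (w₂ : (GG len cl).Walk u₂ u₂), w₂.IsCycle →
          ∀ e : Sym2 (VV len), e ∈ w₁.edges → e ∈ w₂.edges →
            ∀ e' : Sym2 (VV len), e' ∈ w₁.edges ↔ e' ∈ w₂.edges) ∧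
    {s : Set (Sym2 (VV len)) | ∃ (u : VV len) (w : (GG len cl).Walk u u),
      w.IsCycle ∧ s = {e | e ∈ w.edges}}.ncard = {b | cl b = true}.ncard ∧
    (∀ (u : VV len) (w : (GG len cl).Walk u u), w.IsCycle → w.length = c) := by
  have hb : ∀ b, cl b = true → 2 ≤ len b := fun b h => by have := hb2 b h; omega
  refine ⟨?_, ?_, ?_⟩
  · intro u1 w1 h1 u2 w2 h2 e he1 he2 e'
    obtain ⟨b1, hc1, hs1, -⟩ := cyc_struct len cl w1 h1 hb
    obtain ⟨b2, hc2, hs2, -⟩ := cyc_struct len cl w2 h2 hb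
    have m1 : e ∈ Cset len cl b1 := by rw [← hs1]; exact he1
    have m2 : e ∈ Cset len cl b2 := by rw [← hs2]; exact he2
    have : b1 = b2 := by
      obtain ⟨hadj, i, hi⟩ := m1
      obtain ⟨-, j, hj⟩ := m2
      induction e with
      | _ x y =>
      have hadj' : adjF len cl x y := hadj
      rw [Sym2.mem_iff] at hi hj
      rcases hi with rfl | rfl <;> rcases hj with hj | hj
      · simp only [Option.some.injEq, Sigma.mk.injEq] at hj
        exact hj.1.symm
      · subst hj
        exact hadj'.1
      · subst hj
        exact hadj'.1.symm
      · simp only [Option.some.injEq, Sigma.mk.injEq] at hj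
        exact hj.1.symm
    subst this
    have : e' ∈ {e | e ∈ w1.edges} ↔ e' ∈ {e | e ∈ w2.edges} := by rw [hs1, hs2]
    exact this
  · have : {s : Set (Sym2 (VV len)) | ∃ (u : VV len) (w : (GG len cl).Walk u u),
      w.IsCycle ∧ s = {e | e ∈ w.edges}} = Cset len cl '' {b | cl b = true} := by
      ext s
      constructor
      · rintro ⟨u, w, hw, rfl⟩
        obtain ⟨b, h1, h2, -⟩ := cyc_struct len cl w hw hb
        exact ⟨b, h1, h2.symm⟩
      · rintro ⟨b, h1, rfl⟩
        obtain ⟨u, w, hw, he⟩ := cyc_exists len cl b h1 (hb b h1)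
        obtain ⟨b', h1', h2', -⟩ := cyc_struct len cl w hw hb
        have hm : s(none, some ⟨b, ⟨0, by have := hb b h1; omega⟩⟩) ∈ {e | e ∈ w.edges} := he
        rw [h2'] at hm
        have := Cset_first len cl b b' _ hm
        subst this
        exact ⟨u, w, hw, h2'.symm⟩
    rw [this, Set.InjOn.ncard_image]
    intro b h1 b' h1' e
    have hl : 1 ≤ len b := by have := hb b h1; omega
    apply Cset_first len cl b b' hl
    rw [← e]
    exact ⟨Or.inl rfl, _, Sym2.mem_mk_right _ _⟩
  · intro u w hw
    obtain ⟨b, h1, -, h3⟩ := cyc_struct len cl w hw hb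
    rw [h3, hb2 b h1]

end
end Cac

set_option linter.unusedSectionVars false
set_option linter.unusedTactic false
set_option linter.unusedVariables false
set_option linter.unreachableTactic false

namespace Cac

lemma EE_refl (c j a b : ℕ) (hj : 0 < j) (hjc : j < c) (ha : 0 < a) (hac : a < c)
    (hb : 0 < b) (hbc : b < c) : EE c (c - j) (c - a) (c - b) = EE c j a b := by
  have e : ad (c - a) (c - b) = ad a b := by unfold ad; omega
  unfold EE
  rw [e]
  by_cases h : a = j ∨ b = j
  · rw [if_pos h, if_pos (by omega)]
  · rw [if_neg h, if_neg (by omega)]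
    by_cases h2 : (a < j ↔ b < j)
    · rw [if_pos h2, if_pos (by omega)]
    · rw [if_neg h2, if_neg (by omega)]

lemma EE_refl0 (c j b : ℕ) (hj : 0 < j) (hjc : j < c) 
    (hb : 0 < b) (hbc : b < c) : EE c (c - j) 0 (c - b) = EE c j 0 b := by
  by_cases h : b = j
  · subst h; simp [EE]
  · rw [EE_zero_left _ _ _ (by omega) (by omega), EE_zero_left _ _ _ (by omega) (by omega)]
    split_ifs <;> omega

lemma Scon_refl (c j : ℕ) (hj : 0 < j) (hjc : j < c) : Scon c (c - j) = Scon c j := by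
  unfold Scon
  rw [← Finset.sum_range_reflect]
  refine Finset.sum_congr rfl fun b hb => ?_
  rw [Finset.mem_range] at hb
  rw [← EE_refl0 c j (b + 1) hj hjc (by omega) (by omega)]
  congr 1
  omega

lemma Acon_refl (c j : ℕ) (hj : 0 < j) (hjc : j < c) : Acon c (c - j) = Acon c j := by
  unfold Acon
  rw [← Finset.sum_range_reflect]
  refine Finset.sum_congr rfl fun a ha => ?_
  rw [← Finset.sum_range_reflect]
  refine Finset.sum_congr rfl fun b hb => ?_
  rw [Finset.mem_range] at hb ha
  rw [← EE_refl c j (a + 1) (b + 1) hj hjc (by omega) (by omega) (by omega) (by omega)]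
  congr 1 <;> omega

lemma cy_refl (c j : ℕ) (hjc : j ≤ c) : cy c (c - j) = cy c j := by
  unfold cy; omega

lemma Kcon_refl (c j : ℕ) (hj : 0 < j) (hjc : j < c) : Kcon c (c - j) = Kcon c j := by
  unfold Kcon
  rw [cy_refl c j hjc.le, ← Finset.sum_range_reflect]
  congr 1
  refine Finset.sum_congr rfl fun b hb => ?_
  rw [Finset.mem_range] at hb
  congr 1
  unfold ad
  omega

lemma Acon_even (c j : ℕ) : ∃ n, Acon c j = 2 * n := by
  unfold Acon
  have := even_sum (fun x y : Fin (c - 1) => EE c j (x + 1) (y + 1))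
    (by intro x; simp [EE, ad]) (fun x y => EE_symm _ _ _ _)
  have e : ∀ x : Fin (c - 1), ∑ y : Fin (c - 1), EE c j (x + 1) (y + 1) =
      ∑ i ∈ Finset.range (c - 1), EE c j (x + 1) (i + 1) :=
    fun x => Fin.sum_univ_eq_sum_range (fun y => EE c j (x + 1) (y + 1)) _
  simp only [e] at this
  rw [Fin.sum_univ_eq_sum_range
    (fun x => ∑ i ∈ Finset.range (c - 1), EE c j (x + 1) (i + 1))] at this
  exact this

lemma Scon_one (c : ℕ) (hc : 7 ≤ c) : 3 ≤ Scon c 1 := by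
  have : EE c 1 0 (1 + 1) ≤ Scon c 1 :=
    Finset.single_le_sum (f := fun b => EE c 1 0 (b + 1)) (fun _ _ => Nat.zero_le _)
      (Finset.mem_range.2 (by omega))
  rw [EE_zero_left _ _ _ (by omega) (by omega)] at this
  simp at this
  omega

lemma Scon_lt' (c j : ℕ) (h2 : 2 ≤ j) (hj : 2 * j ≤ c) : Scon c j + 2 ≤ Scon c 1 + cy c j := by
  have h1 : Scon c j ≤ Scon c 1 := by
    refine Finset.sum_le_sum fun b hb => ?_
    rw [Finset.mem_range] at hb
    by_cases e : b + 1 = j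
    · rw [e]; simp [EE]
    · rw [EE_zero_left _ _ _ (by omega) (by omega)]
      by_cases e1 : b = 0
      · subst e1
        rw [if_pos (by omega)]
        omega
      · rw [EE_zero_left _ _ _ (by omega) (by omega)]
        split_ifs <;> omega
  have : cy c j = j := by unfold cy; omega
  omega

lemma Scon_lt (c j : ℕ) (h2 : 2 ≤ j) (hj : j + 2 ≤ c) : Scon c j + 2 ≤ Scon c 1 + cy c j := by
  by_cases h : 2 * j ≤ c
  · exact Scon_lt' c j h2 h
  · have := Scon_lt' c (c - j) (by omega) (by omega)
    rwa [cy_refl c j (by omega), Scon_refl c j (by omega) (by omega)] at this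

lemma numeric (k' c N : ℕ) (hc : 7 ≤ c) (K0 : ℕ) : ∃ α p q : ℕ, 1 ≤ α ∧ 1 ≤ p ∧ N < p ∧
    ∀ j, 0 < j → j < c → ∀ M τ : ℕ, M = k' * (c - 1) + p + 2 * α * q →
      τ = k' * K0 + p + q * (α * (2 * α + 1)) →
      ((2 * ((1 + M) * Scon c j) + Acon c j = 2 * (Kcon c j + M * cy c j + τ)) ↔
        j = 1 ∨ j = c - 1) := by
  obtain ⟨A1, hA1⟩ := Acon_even c 1
  obtain ⟨α, hα⟩ : ∃ α, Scon c 1 = α + 3 := ⟨Scon c 1 - 3, by have := Scon_one c hc; omega⟩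
  obtain ⟨C1, hC1⟩ : ∃ C1, C1 = (α + 2) * (1 + k' * (c - 1)) + A1 + 1 := ⟨_, rfl⟩
  obtain ⟨C0, hC0⟩ : ∃ C0, C0 = Kcon c 1 + k' * K0 := ⟨_, rfl⟩
  obtain ⟨X, hX⟩ : ∃ X, X = ∑ j ∈ Finset.range c, Acon c j + c + Kcon c 1 + N + 1 := ⟨_, rfl⟩
  have hpX : X ≤ C1 + (α + 1) * C0 + (α + 2) * X := by nlinarith [Nat.zero_le (α * X), Nat.zero_le ((α+1) * C0)]
  refine ⟨α + 2, C1 + (α + 1) * C0 + (α + 2) * X, C1 + α * C0 + (α + 1) * X,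
    by omega, by omega, by omega, ?_⟩
  intro j hj hjc M τ hM hτ
  generalize hp : C1 + (α + 1) * C0 + (α + 2) * X = p at *
  generalize hq : C1 + α * C0 + (α + 1) * X = q at *
  have key : (1 + M) * (α + 2) + 1 + A1 = Kcon c 1 + τ := by
    have e : C1 + (α + 1) * p = C0 + (α + 2) * q := by rw [← hp, ← hq]; ring
    have e1 : (1 + M) * (α + 2) + 1 + A1 = C1 + (α + 1) * p + p + 2 * (α + 2) * (α + 2) * q := by
      rw [hM, hC1]; ring
    have e2 : Kcon c 1 + τ = C0 + (α + 2) * q + p + 2 * (α + 2) * (α + 2) * q := by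
      rw [hτ, hC0]; ring
    rw [e1, e2, e]
  have cy1 : cy c 1 = 1 := by unfold cy; omega
  have main1 : 2 * ((1 + M) * Scon c 1) + Acon c 1 = 2 * (Kcon c 1 + M * cy c 1 + τ) := by
    rw [hα, hA1, cy1]
    have : (1 + M) * (α + 3) = (1 + M) * (α + 2) + 1 + M := by ring
    omega
  constructor
  · intro h
    by_contra hne
    have hlt := Scon_lt c j (by omega) (by omega)
    have hA : Acon c j ≤ ∑ j ∈ Finset.range c, Acon c j :=
      Finset.single_le_sum (f := fun j => Acon c j) (fun _ _ => Nat.zero_le _)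
        (Finset.mem_range.2 hjc)
    have hcy : cy c j ≤ c := by unfold cy; omega
    have hMp : p ≤ M := by rw [hM]; nlinarith [Nat.zero_le (k' * (c - 1)), Nat.zero_le (2 * (α + 2) * q)]
    rw [hα] at hlt
    have l1 : (1 + M) * (Scon c j + 2) ≤ (1 + M) * (α + 3 + cy c j) := Nat.mul_le_mul_left _ hlt
    have l2 : (1 + M) * (Scon c j + 2) = (1 + M) * Scon c j + 2 + 2 * M := by ring
    have l3 : (1 + M) * (α + 3 + cy c j) = (1 + M) * (α + 2) + 1 + M + cy c j + M * cy c j := by ring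
    omega
  · rintro (rfl | rfl)
    · exact main1
    · rw [Scon_refl c 1 (by omega) (by omega), Acon_refl c 1 (by omega) (by omega),
        Kcon_refl c 1 (by omega) (by omega), cy_refl c 1 (by omega)]
      exact main1

end Cac

namespace Cac

abbrev BB (k p q : ℕ) := Fin k ⊕ Fin p ⊕ Fin q

def lenB (k p q c α : ℕ) : BB k p q → ℕ
  | .inl _ => c - 1
  | .inr (.inl _) => 1
  | .inr (.inr _) => 2 * α

def clB (k p q : ℕ) : BB k p q → Bool
  | .inl _ => true
  | .inr _ => false

lemma sum_leg (n : ℕ) : ∑ i ∈ Finset.range (2 * n), (i + 1) = n * (2 * n + 1) := by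
  induction n with
  | zero => simp
  | succ n ih =>
    rw [show 2 * (n + 1) = 2 * n + 1 + 1 by ring, Finset.sum_range_succ, Finset.sum_range_succ, ih]
    ring

end Cac

open Cac
/-- For every `k ≥ 1` and `c ≥ 7` there are arbitrarily large connected cactus graphs with
exactly `k` cycles, all of length `c`, having exactly `2k` good vertices. -/
theorem exists_large_cactus_with_exactly_two_k_good_vertices (k c N : ℕ)
    (hk : 1 ≤ k) (hc : 7 ≤ c) :
    ∃ (V : Type) (_ : Fintype V) (_ : DecidableEq V) (G : SimpleGraph V),
      G.Connected ∧ N < Fintype.card V ∧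
      -- G is a cactus: every edge lies on at most one cycle (cycles through a common
      -- edge have the same edge-set)
      (∀ (u₁ : V) (w₁ : G.Walk u₁ u₁), w₁.IsCycle →
        ∀ (u₂ : V) (w₂ : G.Walk u₂ u₂), w₂.IsCycle →
          ∀ e : Sym2 V, e ∈ w₁.edges → e ∈ w₂.edges →
            ∀ e' : Sym2 V, e' ∈ w₁.edges ↔ e' ∈ w₂.edges) ∧
      -- G has exactly k cycles (k distinct edge-sets of cycles)
      {s : Set (Sym2 V) | ∃ (u : V) (w : G.Walk u u), w.IsCycle ∧ s = {e | e ∈ w.edges}}.ncard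
        = k ∧
      -- every cycle of G has length c
      (∀ (u : V) (w : G.Walk u u), w.IsCycle → w.length = c) ∧
      -- G has exactly 2k good vertices
      {v : V | good G v}.ncard = 2 * k := by
  obtain ⟨k', rfl⟩ : ∃ k', k = k' + 1 := ⟨k - 1, by omega⟩
  obtain ⟨α, p, q, hα, hp, hpN, hnum⟩ := numeric k' c N hc
    (∑ i ∈ Finset.range (c - 1), min (i + 1) (c - (i + 1)))
  set len := lenB (k' + 1) p q c α with hlen
  set cl := clB (k' + 1) p q with hcl
  have hl : ∀ b, 1 ≤ len b := by
    rintro (_ | _ | _) <;> simp only [hlen, lenB] <;> omega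
  have hb2 : ∀ b, cl b = true → len b + 1 = c := by
    rintro (_ | _ | _) h
    · simp only [hlen, lenB]; omega
    · simp [hcl, clB] at h
    · simp [hcl, clB] at h
  obtain ⟨c1, c2, c3⟩ := cactus_part len cl c hb2 (by omega)
  refine ⟨VV len, inferInstance, inferInstance, GG len cl, ⟨(GG_dist len cl).1⟩, ?_, c1, ?_, c3, ?_⟩
  · rw [Fintype.card_option, Fintype.card_sigma]
    simp only [Fintype.card_fin, Fintype.sum_sum_type, hlen, lenB]
    simp
    nlinarith [Nat.zero_le ((k' + 1) * (c - 1)), Nat.zero_le (q * (2 * α))]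
  · rw [c2]
    have : {b | cl b = true} = Set.range (Sum.inl : Fin (k' + 1) → BB (k' + 1) p q) := by
      ext b
      rcases b with b | b <;> simp [hcl, clB]
    rw [this, ← Set.image_univ, Set.ncard_image_of_injective _ Sum.inl_injective, Set.ncard_univ]
    simp
  · have hclosed : ∀ (i : Fin (k' + 1)) (j : Fin (len (.inl i))),
        good (GG len cl) (some ⟨.inl i, j⟩) ↔ (j.val + 1 = 1 ∨ j.val + 1 = c - 1) := by
      intro i j
      have hj := j.2
      have hli : len (.inl i) = c - 1 := rfl
      rw [good_closed' len cl (.inl i) j c rfl (by omega) _ _ rfl rfl]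
      apply hnum _ (by omega) (by omega)
      · have := Finset.add_sum_erase Finset.univ len (Finset.mem_univ (.inl i))
        rw [hli] at this
        have t : ∑ b, len b = (k' + 1) * (c - 1) + (p + q * (2 * α)) := by
          simp [Fintype.sum_sum_type, hlen, lenB]
        rw [t] at this
        have e1 : (k' + 1) * (c - 1) = k' * (c - 1) + (c - 1) := by ring
        have e2 : q * (2 * α) = 2 * α * q := by ring
        omega
      · have := Finset.add_sum_erase Finset.univ
          (fun b => ∑ i ∈ Finset.range (len b), hh len cl b (i + 1)) (Finset.mem_univ (.inl i))
        have t0 : ∀ i, ∑ i_1 ∈ Finset.range (len (.inl i)), hh len cl (.inl i) (i_1 + 1) =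
            ∑ i ∈ Finset.range (c - 1), min (i + 1) (c - (i + 1)) := by
          intro i
          have hli : len (.inl i) = c - 1 := rfl
          rw [hli]
          refine Finset.sum_congr rfl fun a ha => ?_
          simp only [hh, hcl, clB, if_true]
          rw [hli]
          congr 1
          omega
        have t1 : ∀ i, ∑ i_1 ∈ Finset.range (len (.inr (.inl i))),
            hh len cl (.inr (.inl i)) (i_1 + 1) = 1 := by
          intro i
          have hli : len (.inr (.inl i)) = 1 := rfl
          rw [hli]
          simp [hh, hcl, clB]
        have t2 : ∀ i, ∑ i_1 ∈ Finset.range (len (.inr (.inr i))),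
            hh len cl (.inr (.inr i)) (i_1 + 1) = α * (2 * α + 1) := by
          intro i
          have hli : len (.inr (.inr i)) = 2 * α := rfl
          rw [hli, ← sum_leg]
          simp [hh, hcl, clB]
        rw [Fintype.sum_sum_type, Fintype.sum_sum_type] at this
        simp only [t0, t1, t2, Finset.sum_const, Finset.card_univ, Fintype.card_fin,
          smul_eq_mul, mul_one] at this
        have e1 : ∀ x, (k' + 1) * x = k' * x + x := fun x => by ring
        rw [e1] at this
        omega
    have hset : {v | good (GG len cl) v} = Set.range (fun x : Fin (k' + 1) × Bool =>
        (some ⟨.inl x.1, ⟨if x.2 then 0 else c - 2, by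
          change _ < c - 1
          split_ifs <;> omega⟩⟩ : VV len)) := by
      ext v
      simp only [Set.mem_ofPred_eq, Set.mem_range]
      constructor
      · intro h
        rcases v with (_ | ⟨b, j⟩)
        · exact absurd h (not_good_hub len cl hl (.inl 0) (.inr (.inl ⟨0, hp⟩)) (by simp))
        · rcases b with i | b
          · have hli : len (.inl i) = c - 1 := rfl
            rcases (hclosed i j).1 h with h1 | h1
            · refine ⟨(i, true), ?_⟩
              simp only [if_true]
              congr 2
              exact Fin.ext (by simp; omega)
            · refine ⟨(i, false), ?_⟩
              congr 2
              exact Fin.ext (by simp; omega)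
          · exfalso
            have hj := j.2
            by_cases e : j.val + 1 = len (.inr b)
            · exact not_good_last len cl _ j rfl e h
            · exact not_good_inner len cl _ j rfl (by omega) h
      · rintro ⟨⟨i, t⟩, rfl⟩
        rw [hclosed]
        cases t <;> simp; omega
    rw [hset, ← Set.image_univ, Set.ncard_image_of_injective, Set.ncard_univ]
    · simp; ring
    · rintro ⟨i, t⟩ ⟨i', t'⟩ h
      simp only [Option.some.injEq, Sigma.mk.injEq, Sum.inl.injEq] at h
      obtain ⟨rfl, h⟩ := h
      have h := congrArg Fin.val (eq_of_heq h)
      simp only at h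
      cases t <;> cases t' <;> simp at h ⊢ <;> omega
end

section
/- For every natural number k ≥ 1, every c ∈ {5, 6}, and every natural number N, there exists a finite connected simple graph G with more than N vertices such that: every edge of G lies on at most one cycle of G (G is a cactus), G has exactly k cycles (exactly k distinct edge-sets of cycles), every cycle of G has length c, and G has exactly k good vertices. -/
open SimpleGraph

set_option linter.unusedSectionVars false

/-! ### Distances from an explicit distance function -/

/-- `d` behaves like the graph distance of the relation `adj` restricted to `A`. -/
structure Geo {X : Type} (A : X → Prop) (adj : X → X → Prop) (d : X → X → ℕ) : Prop where
  zero : ∀ u v, A u → A v → (d u v = 0 ↔ u = v)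
  lip : ∀ u v, A u → A v → adj u v → ∀ w, A w → d u w ≤ d v w + 1
  step : ∀ u w, A u → A w → u ≠ w → ∃ v, A v ∧ adj u v ∧ d v w + 1 = d u w

theorem dist_eq_of_geo {V : Type} (G : SimpleGraph V) (d : V → V → ℕ)
    (h0 : ∀ u v, d u v = 0 ↔ u = v)
    (h1 : ∀ u v, G.Adj u v → ∀ w, d u w ≤ d v w + 1)
    (h2 : ∀ u w, u ≠ w → ∃ v, G.Adj u v ∧ d v w + 1 = d u w) :
    G.Preconnected ∧ ∀ u v, G.dist u v = d u v := by
  have hw : ∀ n u w, d u w = n → ∃ p : G.Walk u w, p.length = n := by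
    intro n
    induction n with
    | zero =>
      intro u w h
      obtain rfl := (h0 u w).1 h
      exact ⟨Walk.nil, rfl⟩
    | succ n ih =>
      intro u w h
      have hne : u ≠ w := by
        intro e
        have := (h0 u w).2 e
        omega
      obtain ⟨v, hv, hd⟩ := h2 u w hne
      obtain ⟨p, hp⟩ := ih v w (by omega)
      exact ⟨Walk.cons hv p, by simp [hp]⟩
  have hl : ∀ u w (p : G.Walk u w), d u w ≤ p.length := by
    intro u w p
    induction p with
    | nil => simp [(h0 _ _).2 rfl]
    | cons h p ih =>
      have := h1 _ _ h
      rw [Walk.length_cons]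
      exact (this _).trans (by omega)
  have hc : G.Preconnected := fun u w => by
    obtain ⟨p, -⟩ := hw _ u w rfl
    exact ⟨p⟩
  refine ⟨hc, fun u w => le_antisymm ?_ ?_⟩
  · obtain ⟨p, hp⟩ := hw _ u w rfl
    rw [← hp]
    exact dist_le p
  · obtain ⟨p, hp⟩ := (hc u w).exists_walk_length_eq_dist
    rw [← hp]
    exact hl u w p

/-! ### Wedge of rooted graphs given by distance tables -/

section Wedge

variable {I : Type} [DecidableEq I] {m : ℕ}

/-- Embedding of branch `i` into the wedge; `0` is the hub. -/
def emb (i : I) (x : Fin (m + 1)) : Option (I × Fin m) :=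
  Fin.cases none (fun y => some (i, y)) x

@[simp] theorem emb_zero (i : I) : emb i (0 : Fin (m + 1)) = none := rfl
@[simp] theorem emb_succ (i : I) (x : Fin m) : emb i x.succ = some (i, x) := rfl

theorem emb_inj {i j : I} {x y : Fin (m + 1)} (hx : x ≠ 0) :
    emb i x = emb j y ↔ i = j ∧ x = y := by
  obtain ⟨x, rfl⟩ := Fin.exists_succ_eq.2 hx
  cases y using Fin.cases with
  | zero => simp [Fin.succ_ne_zero]
  | succ y => simp

theorem emb_injective (i : I) : Function.Injective (emb (m := m) i) := by
  intro x y h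
  by_cases hx : x = 0
  · by_cases hy : y = 0
    · rw [hx, hy]
    · exact ((emb_inj hy).1 h.symm).2.symm
  · exact ((emb_inj hx).1 h).2

theorem exists_emb [Nonempty I] (u : Option (I × Fin m)) : ∃ i x, u = emb i x := by
  rcases u with _ | ⟨i, x⟩
  · exact ⟨Classical.arbitrary I, 0, rfl⟩
  · exact ⟨i, x.succ, rfl⟩

/-- The distance function on the wedge. -/
def dW (E : I → Fin (m + 1) → Fin (m + 1) → ℕ) : Option (I × Fin m) → Option (I × Fin m) → ℕ
  | none, none => 0
  | none, some (j, y) => E j 0 y.succ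
  | some (i, x), none => E i x.succ 0
  | some (i, x), some (j, y) =>
    if i = j then E i x.succ y.succ else E i x.succ 0 + E j 0 y.succ

variable {D E : I → Fin (m + 1) → Fin (m + 1) → ℕ}

theorem dW_same (h : ∀ i, E i 0 0 = 0) (i : I) (x y : Fin (m + 1)) :
    dW E (emb i x) (emb i y) = E i x y := by
  cases x using Fin.cases <;> cases y using Fin.cases <;> simp [dW, h]

theorem dW_ne (h : ∀ i, E i 0 0 = 0) {i j : I} (hij : i ≠ j) (x y : Fin (m + 1)) :
    dW E (emb i x) (emb j y) = E i x 0 + E j 0 y := by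
  cases x using Fin.cases <;> cases y using Fin.cases <;> simp [dW, h, hij]

theorem dW_symm (hs : ∀ i x y, E i x y = E i y x) (u v : Option (I × Fin m)) :
    dW E u v = dW E v u := by
  rcases u with _ | ⟨i, x⟩ <;> rcases v with _ | ⟨j, y⟩
  · rfl
  · exact hs _ _ _
  · exact hs _ _ _
  · simp only [dW]
    by_cases h : i = j
    · subst h; simp [hs i x.succ]
    · rw [if_neg h, if_neg (Ne.symm h), hs i, hs j]; omega

/-- Basic facts on tables. -/
structure Tab (D : I → Fin (m + 1) → Fin (m + 1) → ℕ) : Prop where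
  symm : ∀ i x y, D i x y = D i y x
  geo : ∀ i, Geo (fun _ => True) (fun x y => D i x y = 1) (D i)

theorem Tab.zz (h : Tab D) (i : I) (x) : D i x x = 0 := ((h.geo i).zero x x trivial trivial).2 rfl

theorem Tab.eq (h : Tab D) (i : I) {x y} (e : D i x y = 0) : x = y :=
  ((h.geo i).zero x y trivial trivial).1 e

theorem adjW (h : Tab D) {i j : I} {x y : Fin (m + 1)}
    (e : dW D (emb i x) (emb j y) = 1) :
    ∃ l x' y', emb i x = emb l x' ∧ emb j y = emb l y' ∧ D l x' y' = 1 := by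
  by_cases hij : i = j
  · subst hij
    rw [dW_same (fun i => h.zz i 0)] at e
    exact ⟨i, x, y, rfl, rfl, e⟩
  · rw [dW_ne (fun i => h.zz i 0) hij] at e
    rcases Nat.eq_zero_or_pos (D i x 0) with h0 | h0
    · have := h.eq i h0
      subst this
      exact ⟨j, 0, y, rfl, rfl, by omega⟩
    · have h1 : D j 0 y = 0 := by omega
      have := h.eq j h1
      subst this
      exact ⟨i, x, 0, rfl, rfl, by omega⟩

theorem adjW' [Nonempty I] (h : Tab D) {u v : Option (I × Fin m)} (e : dW D u v = 1) :
    ∃ l x y, u = emb l x ∧ v = emb l y ∧ D l x y = 1 := by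
  obtain ⟨i, x, rfl⟩ := exists_emb u
  obtain ⟨j, y, rfl⟩ := exists_emb v
  exact adjW h e

/-- neighbours of a non-hub vertex stay in the branch -/
theorem adjW_emb [Nonempty I] (h : Tab D) {i : I} {x : Fin (m + 1)} (hx : x ≠ 0)
    {v : Option (I × Fin m)} (e : dW D (emb i x) v = 1) : ∃ y, v = emb i y ∧ D i x y = 1 := by
  obtain ⟨l, x', y, h1, h2, h3⟩ := adjW' h e
  obtain ⟨rfl, rfl⟩ := (emb_inj hx).1 h1
  exact ⟨y, h2, h3⟩

theorem geoW [Nonempty I] (h : Tab D) (A : I → Fin (m + 1) → Prop) (hA0 : ∀ i, A i 0)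
    (hg : ∀ i, Geo (A i) (fun x y => D i x y = 1) (E i)) :
    Geo (fun u => ∀ i x, u = emb i x → A i x) (fun u v => dW D u v = 1) (dW E) := by
  have hE : ∀ i, E i 0 0 = 0 := fun i => ((hg i).zero 0 0 (hA0 i) (hA0 i)).2 rfl
  have key : ∀ i x, A i x → ∀ j y, emb i x = emb j y → A j y := by
    intro i x hx j y e
    by_cases hy : y = 0
    · subst hy; exact hA0 j
    · obtain ⟨rfl, rfl⟩ := (emb_inj hy).1 e.symm
      exact hx
  refine ⟨?_, ?_, ?_⟩
  · intro u v hu hv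
    obtain ⟨i, x, rfl⟩ := exists_emb u
    obtain ⟨j, y, rfl⟩ := exists_emb v
    have ax := hu i x rfl
    have ay := hv j y rfl
    by_cases hij : i = j
    · subst hij
      rw [dW_same hE, (hg i).zero x y ax ay]
      exact (emb_injective i).eq_iff.symm
    · rw [dW_ne hE hij]
      constructor
      · intro e
        have h1 := ((hg i).zero x 0 ax (hA0 i)).1 (by omega)
        have h2 := ((hg j).zero 0 y (hA0 j) ay).1 (by omega)
        subst h1
        subst h2
        rfl
      · intro e
        by_cases hx : x = 0
        · subst hx
          by_cases hy : y = 0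
          · subst hy; simp [hE]
          · exact absurd ((emb_inj hy).1 e.symm).1.symm hij
        · exact absurd ((emb_inj hx).1 e).1 hij
  · intro u v hu hv huv w hw
    obtain ⟨l, x, y, rfl, rfl, hd⟩ := adjW' h huv
    obtain ⟨j, z, rfl⟩ := exists_emb w
    have ax := hu l x rfl
    have ay := hv l y rfl
    have az := hw j z rfl
    by_cases hij : l = j
    · subst hij
      rw [dW_same hE, dW_same hE]
      exact (hg l).lip x y ax ay hd z az
    · rw [dW_ne hE hij, dW_ne hE hij]
      have := (hg l).lip x y ax ay hd 0 (hA0 l)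
      omega
  · intro u w hu hw huw
    have hD : ∀ i, D i 0 0 = 0 := fun i => h.zz i 0
    have same : ∀ i x z, A i x → A i z → emb i x ≠ emb i z →
        ∃ v, (∀ i x, v = emb i x → A i x) ∧ dW D (emb i x) v = 1 ∧
          dW E v (emb i z) + 1 = dW E (emb i x) (emb i z) := by
      intro i x z ax az hne
      obtain ⟨y, ay, h1, h2⟩ := (hg i).step x z ax az (fun e => hne (by rw [e]))
      exact ⟨emb i y, key i y ay, by rw [dW_same hD]; exact h1,
        by rw [dW_same hE, dW_same hE]; exact h2⟩
    obtain ⟨i, x, rfl⟩ := exists_emb u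
    obtain ⟨j, z, rfl⟩ := exists_emb w
    have ax := hu i x rfl
    have az := hw j z rfl
    by_cases hij : i = j
    · subst hij
      exact same i x z ax az huw
    · by_cases hx : x = 0
      · subst hx
        exact same j 0 z (hA0 j) az huw
      · obtain ⟨y, ay, h1, h2⟩ := (hg i).step x 0 ax (hA0 i) hx
        exact ⟨emb i y, key i y ay, by rw [dW_same hD]; exact h1,
          by rw [dW_ne hE hij, dW_ne hE hij]; omega⟩

/-- The wedge graph. -/
def GW (D : I → Fin (m + 1) → Fin (m + 1) → ℕ) (h : Tab D) :
    SimpleGraph (Option (I × Fin m)) where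
  Adj u v := dW D u v = 1
  symm := ⟨fun u v e => by rw [dW_symm h.symm]; exact e⟩
  loopless := ⟨fun u e => by
    rcases u with _ | ⟨i, x⟩
    · simp [dW] at e
    · simp [dW, h.zz] at e⟩

theorem GW_dist [Nonempty I] (h : Tab D) :
    (GW D h).Connected ∧ ∀ u v, (GW D h).dist u v = dW D u v := by
  have hg := geoW h (E := D) (fun _ _ => True) (fun _ => trivial) h.geo
  have hfin := dist_eq_of_geo (GW D h) (dW D)
    (fun u v => hg.zero u v (by simp) (by simp))
    (fun u v e w => hg.lip u v (by simp) (by simp) e w (by simp))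
    (fun u w e => by
      obtain ⟨v, -, h1, h2⟩ := hg.step u w (by simp) (by simp) e
      exact ⟨v, h1, h2⟩)
  have : Nonempty (Option (I × Fin m)) := ⟨none⟩
  exact ⟨⟨hfin.1⟩, hfin.2⟩

/-- Distances after deleting the vertex `z` of branch `i`. -/
theorem GW_del_dist [Nonempty I] (h : Tab D) (i : I) (z : Fin (m + 1)) (hz : z ≠ 0)
    (D' : Fin (m + 1) → Fin (m + 1) → ℕ)
    (hD' : Geo (fun x => x ≠ z) (fun x y => D i x y = 1) D') :
    (delVert (GW D h) (emb i z)).Connected ∧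
      ∀ u v, (delVert (GW D h) (emb i z)).dist u v = dW (Function.update D i D') u.1 v.1 := by
  have hg := geoW h (E := Function.update D i D') (fun j x => j = i → x ≠ z)
    (fun _ _ => hz.symm) (fun j => by
      by_cases hj : j = i
      · subst hj
        simpa using hD'
      · have := h.geo j
        simpa [hj] using this)
  have hA : ∀ u : {u : Option (I × Fin m) // u ≠ emb i z},
      ∀ j x, u.1 = emb j x → j = i → x ≠ z := by
    rintro ⟨u, hu⟩ j x rfl rfl rfl
    exact hu rfl
  have hfin := dist_eq_of_geo (delVert (GW D h) (emb i z))
    (fun u v => dW (Function.update D i D') u.1 v.1)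
    (fun u v => by rw [hg.zero u v (hA u) (hA v), Subtype.ext_iff])
    (fun u v e w => hg.lip u v (hA u) (hA v) e w (hA w))
    (fun u w e => by
      obtain ⟨v, h0, h1, h2⟩ := hg.step u w (hA u) (hA w) (fun e' => e (Subtype.ext e'))
      exact ⟨⟨v, fun e => h0 i z e rfl rfl⟩, h1, h2⟩)
  have : Nonempty {u : Option (I × Fin m) // u ≠ emb i z} :=
    ⟨⟨none, fun e => hz ((emb_inj (j := i) (y := 0) hz).1 e.symm).2⟩⟩
  exact ⟨⟨hfin.1⟩, hfin.2⟩

end Wedge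

/-! ### Cycles of a graph whose non-bridge edges form disjoint cycles -/

section Cycles

open scoped Fin.NatCast Fin.CommRing

variable {V J : Type} {n : ℕ} {G : SimpleGraph V} {C : J → Fin (n + 1) → V}

theorem fin_cyc_ind {P : Fin (n + 1) → Prop} (j : Fin (n + 1)) (h0 : P j)
    (hs : ∀ x, P x → P (x + 1)) (x : Fin (n + 1)) : P x := by
  have : ∀ t : ℕ, P (j + (t : Fin (n + 1))) := by
    intro t
    induction t with
    | zero => simpa using h0
    | succ t ih =>
      have := hs _ ih
      rwa [add_assoc, ← Nat.cast_succ] at this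
  have h := this (x - j).val
  rwa [Fin.cast_val_eq_self, add_sub_cancel] at h

theorem cyc_walk
    (hinj : ∀ i j x y, C i x = C j y → i = j ∧ x = y)
    {i : J} {u v : V} (p : G.Walk u v)
    (hp : ∀ e ∈ p.edges, ∃ i x, e = s(C i x, C i (x + 1)))
    (hu : ∃ x, u = C i x) : ∀ w ∈ p.support, ∃ x, w = C i x := by
  induction p with
  | nil => simpa using hu
  | @cons a b c h p ih =>
    intro w hw
    rw [Walk.support_cons, List.mem_cons] at hw
    rcases hw with rfl | hw
    · exact hu
    · refine ih (fun e he => hp e (by simp [he])) ?_ w hw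
      obtain ⟨x, rfl⟩ := hu
      obtain ⟨i', x', e⟩ := hp s(C i x, b) (by simp)
      rw [Sym2.eq_iff] at e
      rcases e with ⟨e1, e2⟩ | ⟨e1, e2⟩
      · obtain ⟨rfl, rfl⟩ := hinj _ _ _ _ e1
        exact ⟨_, e2⟩
      · obtain ⟨rfl, rfl⟩ := hinj _ _ _ _ e1
        exact ⟨_, e2⟩

theorem cyc_classify
    (hinj : ∀ i j x y, C i x = C j y → i = j ∧ x = y)
    (hbr : ∀ u v, G.Adj u v → (∃ i x, s(u, v) = s(C i x, C i (x + 1))) ∨ G.IsBridge s(u, v))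
    {u : V} (w : G.Walk u u) (hw : w.IsCycle) :
    ∃ i, ∀ e, e ∈ w.edges ↔ ∃ x, e = s(C i x, C i (x + 1)) := by
  have hedge : ∀ e ∈ w.edges, ∃ i x, e = s(C i x, C i (x + 1)) := by
    intro e he
    induction e with
    | h a b =>
      rcases hbr a b (w.adj_of_mem_edges he) with h | h
      · exact h
      · exact absurd he (h.notMem_edges_of_isCycle hw)
  -- the start vertex lies on a cycle
  have hstart : ∃ i x, u = C i x := by
    have hnn : ¬ w.Nil := hw.not_nil
    have h1 : s(u, w.snd) ∈ w.edges := by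
      rw [← Walk.adj_toSubgraph_iff_mem_edges]
      exact w.toSubgraph_adj_snd hnn
    obtain ⟨i, x, e⟩ := hedge _ h1
    rw [Sym2.eq_iff] at e
    rcases e with ⟨e1, -⟩ | ⟨e1, -⟩
    exacts [⟨_, _, e1⟩, ⟨_, _, e1⟩]
  obtain ⟨i, x0, hx0⟩ := hstart
  have hsupp := cyc_walk hinj w hedge ⟨x0, hx0⟩
  have hnbr : ∀ x, C i x ∈ w.support →
      s(C i x, C i (x + 1)) ∈ w.edges := by
    intro x hx
    have h2 := hw.ncard_neighborSet_toSubgraph_eq_two hx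
    have hsub : w.toSubgraph.neighborSet (C i x) ⊆ {C i (x - 1), C i (x + 1)} := by
      intro b hb
      have hb' : s(C i x, b) ∈ w.edges := Walk.adj_toSubgraph_iff_mem_edges.1 hb
      obtain ⟨i', x', e⟩ := hedge _ hb'
      rw [Sym2.eq_iff] at e
      rcases e with ⟨e1, e2⟩ | ⟨e1, e2⟩
      · obtain ⟨rfl, rfl⟩ := hinj _ _ _ _ e1
        right; exact e2
      · obtain ⟨rfl, rfl⟩ := hinj _ _ _ _ e1
        left; simpa using e2
    have heq := Set.eq_of_subset_of_ncard_le hsub (by rw [h2]; exact (Set.ncard_insert_le _ _).trans (by simp)) (Set.toFinite _)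
    have hm : C i (x + 1) ∈ w.toSubgraph.neighborSet (C i x) := by rw [heq]; simp
    exact Walk.adj_toSubgraph_iff_mem_edges.1 hm
  have hall : ∀ x, C i x ∈ w.support :=
    fin_cyc_ind x0 (hx0 ▸ w.start_mem_support)
      (fun x hx => w.snd_mem_support_of_mem_edges (hnbr x hx))
  refine ⟨i, fun e => ⟨fun he => ?_, ?_⟩⟩
  · obtain ⟨i', x, rfl⟩ := hedge e he
    obtain ⟨y, hy⟩ := hsupp _ (w.fst_mem_support_of_mem_edges he)
    obtain ⟨rfl, rfl⟩ := hinj _ _ _ _ hy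
    exact ⟨_, rfl⟩
  · rintro ⟨x, rfl⟩
    exact hnbr x (hall x)

theorem cyc_exists (hn : 2 ≤ n)
    (hinj : ∀ i j x y, C i x = C j y → i = j ∧ x = y)
    (hadj : ∀ i x, G.Adj (C i x) (C i (x + 1))) (i : J) :
    ∃ (u : V) (w : G.Walk u u), w.IsCycle ∧ s(C i 0, C i (0 + 1)) ∈ w.edges := by
  have hb : ¬ G.IsBridge s(C i 0, C i (0 + 1)) := by
    rw [isBridge_iff, not_not]
    have step : ∀ x : Fin (n + 1), x ≠ 0 →
        (G.deleteEdges {s(C i 0, C i (0 + 1))}).Adj (C i x) (C i (x + 1)) := by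
      intro x hx
      rw [deleteEdges_adj]
      refine ⟨hadj i x, ?_⟩
      rw [Set.mem_singleton_iff, Sym2.eq_iff]
      rintro (⟨e1, -⟩ | ⟨e1, e2⟩)
      · exact hx (hinj _ _ _ _ e1).2
      · have h1 := (hinj _ _ _ _ e1).2
        have h2 := (hinj _ _ _ _ e2).2
        rw [h1, Fin.ext_iff] at h2
        simp only [zero_add, Fin.val_add, Fin.val_one', Fin.val_zero] at h2
        rw [Nat.mod_eq_of_lt (show 1 < n + 1 by omega),
          Nat.mod_eq_of_lt (show 1 + 1 < n + 1 by omega)] at h2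
        omega
    have reach : ∀ t : ℕ, t + 1 ≤ n →
        (G.deleteEdges {s(C i 0, C i (0 + 1))}).Reachable (C i (0 + 1)) (C i ((t + 1 : ℕ) : Fin (n + 1))) := by
      intro t
      induction t with
      | zero => intro _; simp
      | succ t ih =>
        intro ht
        refine (ih (by omega)).trans ?_
        have := step ((t + 1 : ℕ) : Fin (n + 1)) (by
          rw [Ne, Fin.ext_iff, Fin.val_natCast, Nat.mod_eq_of_lt (by omega)]; simp)
        rw [← Nat.cast_succ] at this
        exact this.reachable
    have h1 := reach (n - 1) (by omega)
    have h2 := step (Fin.last n) (by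
      rw [Ne, Fin.ext_iff]; simp; omega)
    rw [Fin.last_add_one] at h2
    have e : ((n - 1 + 1 : ℕ) : Fin (n + 1)) = Fin.last n := by
      rw [Nat.sub_add_cancel (by omega)]; simp
    rw [e] at h1
    exact (h1.trans h2.reachable).symm
  rw [isBridge_iff_forall_cycle_notMem (by exact hadj i 0)] at hb
  push Not at hb
  obtain ⟨u, p, hp, he⟩ := hb
  exact ⟨u, p, hp, he⟩

theorem cyc_main [Finite J] (hn : 2 ≤ n)
    (hinj : ∀ i j x y, C i x = C j y → i = j ∧ x = y)
    (hadj : ∀ i x, G.Adj (C i x) (C i (x + 1)))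
    (hbr : ∀ u v, G.Adj u v → (∃ i x, s(u, v) = s(C i x, C i (x + 1))) ∨ G.IsBridge s(u, v)) :
    (∀ (u₁ : V) (w₁ : G.Walk u₁ u₁), w₁.IsCycle →
        ∀ (u₂ : V) (w₂ : G.Walk u₂ u₂), w₂.IsCycle →
          ∀ e : Sym2 V, e ∈ w₁.edges → e ∈ w₂.edges →
            ∀ e' : Sym2 V, e' ∈ w₁.edges ↔ e' ∈ w₂.edges) ∧
      {s : Set (Sym2 V) | ∃ (u : V) (w : G.Walk u u), w.IsCycle ∧ s = {e | e ∈ w.edges}}.ncard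
        = Nat.card J ∧
      (∀ (u : V) (w : G.Walk u u), w.IsCycle → w.length = n + 1) := by
  have hcl := fun (u : V) (w : G.Walk u u) (hw : w.IsCycle) => cyc_classify hinj hbr w hw
  have hdis : ∀ i j x y, s(C i x, C i (x + 1)) = s(C j y, C j (y + 1)) → i = j := by
    intro i j x y e
    rw [Sym2.eq_iff] at e
    rcases e with ⟨e1, -⟩ | ⟨e1, -⟩
    exacts [(hinj _ _ _ _ e1).1, (hinj _ _ _ _ e1).1]
  refine ⟨?_, ?_, ?_⟩
  · intro u₁ w₁ h₁ u₂ w₂ h₂ e he₁ he₂ e'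
    obtain ⟨i, hi⟩ := hcl _ w₁ h₁
    obtain ⟨j, hj⟩ := hcl _ w₂ h₂
    obtain ⟨x, rfl⟩ := (hi _).1 he₁
    obtain ⟨y, hy⟩ := (hj _).1 he₂
    obtain rfl := hdis _ _ _ _ hy
    rw [hi, hj]
  · rw [← Set.ncard_range_of_injective
      (f := fun i : J => {e : Sym2 V | ∃ x, e = s(C i x, C i (x + 1))})]
    · congr 1
      ext s
      constructor
      · rintro ⟨u, w, hw, rfl⟩
        obtain ⟨i, hi⟩ := hcl _ w hw
        exact ⟨i, by ext e; exact (hi e).symm⟩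
      · rintro ⟨i, rfl⟩
        obtain ⟨u, w, hw, he⟩ := cyc_exists hn hinj hadj i
        obtain ⟨j, hj⟩ := hcl _ w hw
        obtain ⟨y, hy⟩ := (hj _).1 he
        obtain rfl := hdis _ _ _ _ hy
        exact ⟨u, w, hw, by ext e; exact (hj e).symm⟩
    · intro i j hij
      have : s(C i 0, C i (0 + 1)) ∈ {e : Sym2 V | ∃ x, e = s(C j x, C j (x + 1))} := by
        have h0 : s(C i 0, C i (0 + 1)) ∈ {e : Sym2 V | ∃ x, e = s(C i x, C i (x + 1))} := ⟨0, rfl⟩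
        simpa only [hij] using h0
      obtain ⟨y, hy⟩ := this
      exact hdis _ _ _ _ hy
  · intro u w hw
    classical
    obtain ⟨i, hi⟩ := hcl _ w hw
    rw [← Walk.length_edges, ← List.toFinset_card_of_nodup hw.isTrail.edges_nodup]
    have : w.edges.toFinset = Finset.univ.image (fun x => s(C i x, C i (x + 1))) := by
      ext e
      simp [hi, eq_comm]
    rw [this, Finset.card_image_of_injective, Finset.card_univ, Fintype.card_fin]
    intro x y e
    rw [Sym2.eq_iff] at e
    rcases e with ⟨e1, -⟩ | ⟨e1, e2⟩
    · exact (hinj _ _ _ _ e1).2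
    · have h1 := (hinj _ _ _ _ e1).2
      have h2 := (hinj _ _ _ _ e2).2
      rw [h1, add_assoc, add_eq_left, Fin.ext_iff, Fin.val_add, Fin.val_one',
        Nat.mod_eq_of_lt (show 1 < n + 1 by omega),
          Nat.mod_eq_of_lt (show 1 + 1 < n + 1 by omega)] at h2
      simp at h2

end Cycles

/-! ### Sums of distances -/

section Sums

variable {I : Type} [DecidableEq I] [Fintype I] {m : ℕ}

theorem sum_del {V : Type} [Fintype V] [DecidableEq V] (f : V → V → ℕ) (hs : ∀ u v, f u v = f v u)
    (v : V) (hv : f v v = 0) :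
    ∑ u : {u : V // u ≠ v}, ∑ w : {u : V // u ≠ v}, f u.1 w.1 + 2 * ∑ w, f v w
      = ∑ u, ∑ w, f u w := by
  have h1 : ∀ u : V, ∑ w, f u w = f u v + ∑ w : {u : V // u ≠ v}, f u w.1 := fun u =>
    Fintype.sum_eq_add_sum_subtype_ne _ v
  rw [Fintype.sum_eq_add_sum_subtype_ne (fun u => ∑ w, f u w) v]
  simp only [h1, Finset.sum_add_distrib]
  have h2 : ∑ u : {u : V // u ≠ v}, f u.1 v = ∑ u : {u : V // u ≠ v}, f v u.1 :=
    Finset.sum_congr rfl fun u _ => hs _ _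
  rw [h2, hv]
  omega

/-- Row sums in the wedge. -/
theorem row_sum (E : I → Fin (m + 1) → Fin (m + 1) → ℕ) (hz : ∀ i, E i 0 0 = 0)
    (i : I) (x : Fin (m + 1)) :
    ∑ w, dW E (emb i x) w + ∑ y, E i 0 y + m * E i x 0 =
      ∑ y, E i x y + Fintype.card I * (m * E i x 0) + ∑ j, ∑ y, E j 0 y := by
  rw [Fintype.sum_option, Fintype.sum_prod_type]
  have h1 : ∀ j, ∑ y, dW E (emb i x) (some (j, y)) +
        (if i = j then (m * E i x 0 + ∑ y : Fin m, E i 0 y.succ) else 0)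
      = (m * E i x 0 + ∑ y : Fin m, E j 0 y.succ) +
        (if i = j then ∑ y : Fin m, E i x y.succ else 0) := by
    intro j
    by_cases hij : i = j
    · subst hij
      simp only [if_true, ← emb_succ, dW_same hz]
      omega
    · simp only [if_neg hij, ← emb_succ, dW_ne hz hij]
      simp [Finset.sum_add_distrib]
  have h2 := Finset.sum_congr (s₁ := Finset.univ) rfl (fun j (_ : j ∈ Finset.univ) => h1 j)
  simp only [Finset.sum_add_distrib, Finset.sum_ite_eq, Finset.mem_univ, if_true,
    Finset.sum_const, Finset.card_univ, smul_eq_mul] at h2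
  have h3 : dW E (emb i x) none = E i x 0 := by rw [← emb_zero i, dW_same hz]
  rw [h3]
  simp only [Fin.sum_univ_succ (n := m), hz]
  simp only [zero_add]
  omega

theorem total_sum (E : I → Fin (m + 1) → Fin (m + 1) → ℕ) (hz : ∀ i, E i 0 0 = 0)
    (hs : ∀ i x y, E i x y = E i y x) :
    ∑ u, ∑ w, dW E u w + 2 * (m * ∑ i, ∑ y, E i 0 y)  =
      ∑ i, ∑ x, ∑ y, E i x y + 2 * (Fintype.card I * m * ∑ i, ∑ y, E i 0 y) := by
  rw [Fintype.sum_option, Fintype.sum_prod_type]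
  have hc : ∀ i, ∑ x : Fin m, E i x.succ 0 = ∑ y, E i 0 y := by
    intro i
    rw [Fin.sum_univ_succ, hz, zero_add]
    exact Finset.sum_congr rfl fun x _ => hs _ _ _
  have hT : ∀ i, ∑ x, ∑ y, E i x y = ∑ y, E i 0 y + ∑ x : Fin m, ∑ y, E i x.succ y := by
    intro i
    rw [Fin.sum_univ_succ]
  have h1 : ∀ i, ∑ x : Fin m, ∑ w, dW E (some (i, x)) w + m * ∑ y, E i 0 y + m * ∑ y, E i 0 y =
      ∑ x : Fin m, ∑ y, E i x.succ y + Fintype.card I * (m * ∑ y, E i 0 y)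
        + m * ∑ j, ∑ y, E j 0 y := by
    intro i
    have h2 := Finset.sum_congr (s₁ := Finset.univ) rfl
      (fun x (_ : x ∈ (Finset.univ : Finset (Fin m))) => row_sum E hz i x.succ)
    simp only [Finset.sum_add_distrib, ← Finset.mul_sum, hc, emb_succ,
      Finset.sum_const, Finset.card_univ, smul_eq_mul, Fintype.card_fin] at h2
    exact h2
  have h2 := Finset.sum_congr (s₁ := Finset.univ) rfl
      (fun x (_ : x ∈ (Finset.univ : Finset I)) => h1 x)
  simp only [Finset.sum_add_distrib, ← Finset.mul_sum,
      Finset.sum_const, Finset.card_univ, smul_eq_mul] at h2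
  have h3 : ∑ w, dW E none w = ∑ i, ∑ y, E i 0 y := by
    rw [Fintype.sum_option, Fintype.sum_prod_type]
    simp [dW, Fin.sum_univ_succ (n := m), hz]
  rw [h3]
  simp only [hT, Finset.sum_add_distrib]
  have h4 : Fintype.card I * (m * ∑ i, ∑ y, E i 0 y) = Fintype.card I * m * ∑ i, ∑ y, E i 0 y := by ring
  have h5 : Fintype.card I * (m * ∑ i, ∑ y, E i 0 y) = m * (Fintype.card I * ∑ i, ∑ y, E i 0 y) := by ring
  linarith

end Sums

/-! ### The construction from two branch tables -/

section Main

/-- `y ≠ 0` is a pendant vertex at `x`, and there is a third vertex. -/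
def PC {m : ℕ} (D : Fin (m + 1) → Fin (m + 1) → ℕ) (x : Fin (m + 1)) : Prop :=
  ∃ y, y ≠ 0 ∧ D x y = 1 ∧ (∀ w, D y w = 1 → w = x) ∧ ∃ w, w ≠ x ∧ w ≠ y

/-- `z` has a unique neighbour. -/
def LF {m : ℕ} (D : Fin (m + 1) → Fin (m + 1) → ℕ) (z : Fin (m + 1)) : Prop :=
  ∃ p, p ≠ z ∧ ∀ w, D z w = 1 → w = p

/-- The edge `x p` is the only edge leaving the set of descendants of `x`. -/
def SepE {m : ℕ} (D : Fin (m + 1) → Fin (m + 1) → ℕ) (x p : Fin (m + 1)) : Prop :=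
  D 0 0 ≠ D 0 x + D x 0 ∧ D 0 p ≠ D 0 x + D x p ∧ D 0 x = D 0 x + D x x ∧
    ∀ y, D 0 y = D 0 x + D x y → ∀ y', D y y' = 1 → D 0 y' ≠ D 0 x + D x y' → y = x ∧ y' = p

/-- The finite data of the two kinds of branches. -/
structure Data (m n : ℕ) (D : Bool → Fin (m + 1) → Fin (m + 1) → ℕ)
    (D' : Fin (m + 1) → Fin (m + 1) → ℕ) (cyc : Fin (n + 1) → Fin (m + 1))
    (v : Fin (m + 1)) : Prop where
  hm : 0 < m
  hn : 2 ≤ n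
  symm : ∀ b x y, D b x y = D b y x
  geo : ∀ b, Geo (fun _ => True) (fun x y => D b x y = 1) (D b)
  dsum : ∀ b, ∑ y, D b 0 y = 2 * m
  cyc_inj : Function.Injective cyc
  cyc_ne : ∀ x, cyc x ≠ 0
  cyc_adj : ∀ x, D true (cyc x) (cyc (x + 1)) = 1
  bridge : ∀ b x p, D b x p = 1 →
    (b = true ∧ ∃ j, (x = cyc j ∧ p = cyc (j + 1)) ∨ (p = cyc j ∧ x = cyc (j + 1))) ∨
      SepE (D b) x p ∨ SepE (D b) p x
  kinds : ∀ b z, z ≠ 0 → LF (D b) z ∨ PC (D b) z ∨ (b = true ∧ z = v)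
  pc0 : PC (D false) 0
  v_ne : v ≠ 0
  symm' : ∀ x y, D' x y = D' y x
  z' : D' 0 0 = 0
  geo' : Geo (fun x => x ≠ v) (fun x y => D true x y = 1) D'
  row' : ∀ y, D' v y = D true v y
  tot' : ∑ x, ∑ y, D' x y = ∑ x, ∑ y, D true x y + 2 * ∑ y, D true v y
  root' : ∑ y, D' 0 y = 2 * m + (D true v 0 + 2)

theorem geo_leaf {m : ℕ} {D : Fin (m + 1) → Fin (m + 1) → ℕ} {z : Fin (m + 1)}
    (hs : ∀ x y, D x y = D y x)
    (hg : Geo (fun _ => True) (fun x y => D x y = 1) D) (hl : LF D z) :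
    Geo (fun x => x ≠ z) (fun x y => D x y = 1) D := by
  obtain ⟨p, hp, hz⟩ := hl
  refine ⟨fun u v _ _ => hg.zero u v trivial trivial,
    fun u v _ _ h w _ => hg.lip u v trivial trivial h w trivial, ?_⟩
  intro u w hu hw huw
  obtain ⟨v, -, h1, h2⟩ := hg.step u w trivial trivial huw
  refine ⟨v, ?_, h1, h2⟩
  rintro rfl
  obtain ⟨q, -, h3, h4⟩ := hg.step v w trivial trivial (Ne.symm hw)
  have e1 : u = p := hz u (by rw [hs]; exact h1)
  have e2 := hz q h3
  rw [e1, ← e2] at h2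
  omega

theorem not_good_of_pendant {V : Type} [Fintype V] [DecidableEq V] (G : SimpleGraph V) (z y w : V)
    (hyz : y ≠ z) (hw : w ≠ z) (hwy : w ≠ y) (h : ∀ x, G.Adj y x → x = z) : ¬ good G z := by
  rintro ⟨hc, -⟩
  obtain ⟨p⟩ := hc.preconnected ⟨y, hyz⟩ ⟨w, hw⟩
  cases p with
  | nil => exact hwy rfl
  | @cons _ x _ e p => exact x.2 (h x.1 e)

theorem wiener_eq {V : Type} [Fintype V] {G : SimpleGraph V} {d : V → V → ℕ}
    (h : ∀ u v, G.dist u v = d u v) : wiener G = (∑ u, ∑ v, d u v) / 2 := by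
  simp only [wiener, h]

variable {I : Type} [DecidableEq I] [Fintype I] [Nonempty I] {m n : ℕ}
  {D : Bool → Fin (m + 1) → Fin (m + 1) → ℕ} {D' : Fin (m + 1) → Fin (m + 1) → ℕ}
  {cyc : Fin (n + 1) → Fin (m + 1)} {v : Fin (m + 1)}

theorem Data.tab (H : Data m n D D' cyc v) (τ : I → Bool) : Tab (fun i => D (τ i)) :=
  ⟨fun i => H.symm (τ i), fun i => H.geo (τ i)⟩

theorem not_good_PC (H : Data m n D D' cyc v) (τ : I → Bool) (i : I) (x : Fin (m + 1))
    (h : PC (D (τ i)) x) : ¬ good (GW _ (H.tab τ)) (emb i x) := by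
  obtain ⟨y, hy, h1, h2, w, hw, hwy⟩ := h
  refine not_good_of_pendant _ _ (emb i y) (emb i w) ?_ ((emb_injective i).ne hw)
    ((emb_injective i).ne hwy) ?_
  · apply (emb_injective i).ne
    rintro rfl
    have := (H.tab τ).zz i y
    have : D (τ i) y y = 0 := this
    omega
  · intro u hu
    obtain ⟨q, rfl, hq⟩ := adjW_emb (H.tab τ) hy hu
    rw [h2 q hq]

theorem not_good_LF (H : Data m n D D' cyc v) (τ : I → Bool) (i : I) (z : Fin (m + 1)) (hz : z ≠ 0)
    (h : LF (D (τ i)) z) : ¬ good (GW _ (H.tab τ)) (emb i z) := by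
  rintro ⟨-, hW⟩
  have T := H.tab τ
  have hd := (GW_del_dist T i z hz (D (τ i)) (geo_leaf (H.symm _) (H.geo _) h)).2
  rw [show Function.update (fun i => D (τ i)) i (D (τ i)) = fun i => D (τ i) from
    Function.update_eq_self i (fun i => D (τ i))] at hd
  rw [wiener_eq hd, wiener_eq (GW_dist T).2] at hW
  have h0 : ∀ i : I, (fun i => D (τ i)) i 0 0 = 0 := fun i => T.zz i 0
  have hs := sum_del (dW fun i => D (τ i)) (dW_symm T.symm) (emb i z)
    (by rw [dW_same h0]; exact T.zz i z)
  have hpos : 1 ≤ ∑ w, dW (fun i => D (τ i)) (emb i z) w := by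
    have h1 : dW (fun i => D (τ i)) (emb i z) (emb i 0) ≤ ∑ w, dW (fun i => D (τ i)) (emb i z) w :=
      Finset.single_le_sum (f := fun w => dW (fun i => D (τ i)) (emb i z) w)
        (fun _ _ => Nat.zero_le _) (Finset.mem_univ _)
    rw [dW_same h0] at h1
    have h2 : D (τ i) z 0 ≠ 0 := fun e => hz (T.eq i e)
    change D (τ i) z 0 ≤ _ at h1
    omega
  omega

theorem good_v (H : Data m n D D' cyc v) (τ : I → Bool) (i : I) (hi : τ i = true) :
    good (GW _ (H.tab τ)) (emb i v) := by
  have T := H.tab τ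
  obtain ⟨hc, hd⟩ := GW_del_dist T i v H.v_ne D' (by simpa [hi] using H.geo')
  refine ⟨hc, ?_⟩
  rw [wiener_eq hd, wiener_eq (GW_dist T).2]
  congr 1
  set E : I → Fin (m + 1) → Fin (m + 1) → ℕ := fun i => D (τ i) with hE
  set E' := Function.update E i D' with hE'
  have z1 : ∀ j, E j 0 0 = 0 := fun j => T.zz j 0
  have z2 : ∀ j, E' j 0 0 = 0 := by
    intro j
    by_cases hj : j = i
    · subst hj; simp [hE', H.z']
    · simp [hE', hj, z1]
  have s2 : ∀ j x y, E' j x y = E' j y x := by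
    intro j x y
    by_cases hj : j = i
    · subst hj; simpa [hE'] using H.symm' x y
    · simpa [hE', hj] using T.symm j x y
  have Ei : E i = D true := by simp [hE, hi]
  have Ei' : E' i = D' := by simp [hE']
  have hsum : ∀ f : (Fin (m + 1) → Fin (m + 1) → ℕ) → ℕ,
      ∑ j, f (E' j) + f (D true) = ∑ j, f (E j) + f D' := by
    intro f
    rw [Fintype.sum_eq_add_sum_subtype_ne (fun j => f (E' j)) i,
      Fintype.sum_eq_add_sum_subtype_ne (fun j => f (E j)) i, Ei, Ei']
    have : ∑ j : {j // j ≠ i}, f (E' j.1) = ∑ j : {j // j ≠ i}, f (E j.1) :=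
      Finset.sum_congr rfl fun j _ => by rw [hE', Function.update_of_ne j.2]
    rw [this]
    omega
  have hdel := sum_del (dW E') (dW_symm s2) (emb i v)
    (by rw [dW_same z2, Ei', H.row', ← Ei]; exact T.zz i v)
  have hrow := row_sum E' z2 i v
  rw [Ei'] at hrow
  simp only [H.row', H.root'] at hrow
  have t1 := total_sum E z1 T.symm
  have t2 := total_sum E' z2 s2
  have q1 := hsum fun F => ∑ x, ∑ y, F x y
  have q2 := hsum fun F => ∑ y, F 0 y
  simp only [H.tot', H.root', H.dsum] at q1 q2
  have hR : ∑ j, ∑ y, E j 0 y = Fintype.card I * (2 * m) := by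
    simp [hE, H.dsum]
  have q2' : ∑ j, ∑ y, E' j 0 y = Fintype.card I * (2 * m) + (D true v 0 + 2) := by omega
  rw [q2'] at hrow t2
  rw [hR] at t1
  zify at *
  linarith

theorem main_of_data (H : Data m n D D' cyc v) (k N : ℕ) :
    ∃ (V : Type) (_ : Fintype V) (_ : DecidableEq V) (G : SimpleGraph V),
      G.Connected ∧ N < Fintype.card V ∧
      (∀ (u₁ : V) (w₁ : G.Walk u₁ u₁), w₁.IsCycle →
        ∀ (u₂ : V) (w₂ : G.Walk u₂ u₂), w₂.IsCycle →
          ∀ e : Sym2 V, e ∈ w₁.edges → e ∈ w₂.edges →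
            ∀ e' : Sym2 V, e' ∈ w₁.edges ↔ e' ∈ w₂.edges) ∧
      {s : Set (Sym2 V) | ∃ (u : V) (w : G.Walk u u), w.IsCycle ∧ s = {e | e ∈ w.edges}}.ncard
        = k ∧
      (∀ (u : V) (w : G.Walk u u), w.IsCycle → w.length = n + 1) ∧
      {v : V | good G v}.ncard = k := by
  let τ : Fin k ⊕ Fin (N + 1) → Bool := Sum.isLeft
  have T := H.tab τ
  have z1 : ∀ j, D (τ j) 0 0 = 0 := fun j => T.zz j 0
  have hcyc := cyc_main (G := GW _ (H.tab τ)) (J := Fin k)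
    (C := fun i x => emb (Sum.inl i) (cyc x)) H.hn
    (by
      intro i j x y e
      obtain ⟨h1, h2⟩ := (emb_inj (H.cyc_ne x)).1 e
      exact ⟨Sum.inl_injective h1, H.cyc_inj h2⟩)
    (by
      intro i x
      change dW (fun i => D (τ i)) _ _ = 1
      rw [dW_same z1]
      exact H.cyc_adj x)
    (by
      intro a b hab
      have sep : ∀ l x p, SepE (D (τ l)) x p →
          (GW _ (H.tab τ)).IsBridge s(emb l x, emb l p) := by
        rintro l x p ⟨s0, sp, sx, hS⟩
        rw [isBridge_iff]
        rintro ⟨W⟩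
        have inv : ∀ a b (W : ((GW _ (H.tab τ)).deleteEdges {s(emb l x, emb l p)}).Walk a b),
            (∃ y, D (τ l) 0 y = D (τ l) 0 x + D (τ l) x y ∧ a = emb l y) →
            (∃ y, D (τ l) 0 y = D (τ l) 0 x + D (τ l) x y ∧ b = emb l y) := by
          intro a b W
          induction W with
          | nil => exact id
          | @cons a c b e W ih =>
            rintro ⟨y, hy, rfl⟩
            apply ih
            rw [deleteEdges_adj] at e
            have hy0 : y ≠ 0 := by
              rintro rfl
              exact s0 hy
            obtain ⟨y', rfl, hyy⟩ := adjW_emb (H.tab τ) hy0 e.1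
            by_contra hcon
            have hy' : D (τ l) 0 y' ≠ D (τ l) 0 x + D (τ l) x y' := fun h => hcon ⟨y', h, rfl⟩
            obtain ⟨rfl, rfl⟩ := hS y hy y' hyy hy'
            exact e.2 rfl
        obtain ⟨y, hy, e⟩ := inv _ _ W ⟨x, sx, rfl⟩
        rw [(emb_injective l) e] at sp
        exact sp hy
      obtain ⟨l, x, p, rfl, rfl, hd⟩ := adjW' (H.tab τ) hab
      rcases H.bridge _ _ _ hd with ⟨hl, j, hj⟩ | h | h
      · left
        rcases l with l | l
        · refine ⟨l, j, ?_⟩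
          rcases hj with ⟨rfl, rfl⟩ | ⟨rfl, rfl⟩
          · rfl
          · exact Sym2.eq_swap
        · simp [τ] at hl
      · right; exact sep _ _ _ h
      · right
        rw [Sym2.eq_swap]
        exact sep _ _ _ h)
  refine ⟨_, inferInstance, inferInstance, GW _ (H.tab τ), (GW_dist T).1, ?_, hcyc.1, ?_,
    hcyc.2.2, ?_⟩
  · simp only [Fintype.card_option, Fintype.card_prod, Fintype.card_sum, Fintype.card_fin]
    have := Nat.le_mul_of_pos_right (k + (N + 1)) H.hm
    omega
  · rw [hcyc.2.1]; simp
  · have : {u | good (GW _ (H.tab τ)) u} =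
        Set.range fun i : Fin k => emb (Sum.inl i : Fin k ⊕ Fin (N + 1)) v := by
      ext u
      constructor
      · intro hu
        obtain ⟨l, x, rfl⟩ := exists_emb u
        by_cases hx : x = 0
        · subst hx
          exact absurd hu (not_good_PC H τ (Sum.inr 0) 0 H.pc0)
        · rcases H.kinds (τ l) x hx with h | h | ⟨h, rfl⟩
          · exact absurd hu (not_good_LF H τ l x hx h)
          · exact absurd hu (not_good_PC H τ l x h)
          · rcases l with l | l
            · exact ⟨l, rfl⟩
            · simp [τ] at h
      · rintro ⟨i, rfl⟩
        exact good_v H τ _ rfl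
    rw [this, Set.ncard_range_of_injective]
    · simp
    · intro i j e
      exact Sum.inl_injective ((emb_inj H.v_ne).1 e).1

end Main

/-! ### The concrete tables -/

/-- Distances of a graph consisting of a core (the first `K.length` vertices, with distance
matrix `K`) and pendant vertices; `P` lists the core vertex of every vertex. -/
def tab (n : ℕ) (K : List (List ℕ)) (P : List ℕ) (x y : Fin n) : ℕ :=
  if x.val = y.val then 0 else
    (if x.val < K.length then 0 else 1) + (if y.val < K.length then 0 else 1) +
      (K.getD (P.getD x.val 0) []).getD (P.getD y.val 0) 0

/-- Core of the tree branch. -/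
def KT : List (List ℕ) := [[0, 1, 2], [1, 0, 1], [2, 1, 0]]

/-- Core of the branch with a 5-cycle: root, then the cycle; `5` is the good vertex. -/
def K5 : List (List ℕ) :=
  [[0, 1, 2, 3, 3, 2], [1, 0, 1, 2, 2, 1], [2, 1, 0, 1, 2, 2],
   [3, 2, 1, 0, 1, 2], [3, 2, 2, 1, 0, 1], [2, 1, 2, 2, 1, 0]]

/-- The same after deleting vertex `5`. -/
def K5' : List (List ℕ) :=
  [[0, 1, 2, 3, 4, 2], [1, 0, 1, 2, 3, 1], [2, 1, 0, 1, 2, 2],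
   [3, 2, 1, 0, 1, 2], [4, 3, 2, 1, 0, 1], [2, 1, 2, 2, 1, 0]]

/-- Core of the branch with a 6-cycle: root, then the cycle; `6` is the good vertex. -/
def K6 : List (List ℕ) :=
  [[0, 1, 2, 3, 4, 3, 2], [1, 0, 1, 2, 3, 2, 1], [2, 1, 0, 1, 2, 3, 2], [3, 2, 1, 0, 1, 2, 3],
   [4, 3, 2, 1, 0, 1, 2], [3, 2, 3, 2, 1, 0, 1], [2, 1, 2, 3, 2, 1, 0]]

/-- The same after deleting vertex `6`. -/
def K6' : List (List ℕ) :=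
  [[0, 1, 2, 3, 4, 5, 2], [1, 0, 1, 2, 3, 4, 1], [2, 1, 0, 1, 2, 3, 2], [3, 2, 1, 0, 1, 2, 3],
   [4, 3, 2, 1, 0, 1, 2], [5, 4, 3, 2, 1, 0, 1], [2, 1, 2, 3, 2, 1, 0]]

def P5 : List ℕ := [0, 1, 2, 3, 4, 5, 0, 0, 0, 0, 0, 0, 0, 0, 0, 0, 1, 2, 3, 4, 4, 4]

def P6 : List ℕ := [0, 1, 2, 3, 4, 5, 6, 0, 0, 0, 0, 0, 0, 0, 0, 0, 0, 0, 1, 1, 2, 3, 4, 5]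

def PT5 : List ℕ := [0, 1, 2, 0, 2, 2, 1, 1, 1, 1, 1, 1, 1, 1, 1, 1, 1, 1, 1, 1, 1, 1]

def PT6 : List ℕ := [0, 1, 2, 0, 2, 2, 1, 1, 1, 1, 1, 1, 1, 1, 1, 1, 1, 1, 1, 1, 1, 1, 1, 1]

def D5 (b : Bool) : Fin 22 → Fin 22 → ℕ := if b then tab 22 K5 P5 else tab 22 KT PT5

def D6 (b : Bool) : Fin 24 → Fin 24 → ℕ := if b then tab 24 K6 P6 else tab 24 KT PT6

instance {m : ℕ} (D : Fin (m + 1) → Fin (m + 1) → ℕ) (x : Fin (m + 1)) : Decidable (PC D x) :=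
  inferInstanceAs (Decidable (∃ y, y ≠ 0 ∧ D x y = 1 ∧ (∀ w, D y w = 1 → w = x) ∧
    ∃ w, w ≠ x ∧ w ≠ y))

instance {m : ℕ} (D : Fin (m + 1) → Fin (m + 1) → ℕ) (x : Fin (m + 1)) : Decidable (LF D x) :=
  inferInstanceAs (Decidable (∃ p, p ≠ x ∧ ∀ w, D x w = 1 → w = p))

instance {m : ℕ} (D : Fin (m + 1) → Fin (m + 1) → ℕ) (x p : Fin (m + 1)) :
    Decidable (SepE D x p) :=
  inferInstanceAs (Decidable (D 0 0 ≠ D 0 x + D x 0 ∧ D 0 p ≠ D 0 x + D x p ∧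
    D 0 x = D 0 x + D x x ∧
    ∀ y, D 0 y = D 0 x + D x y → ∀ y', D y y' = 1 → D 0 y' ≠ D 0 x + D x y' → y = x ∧ y' = p))

theorem data5 : Data 21 4 D5 (tab 22 K5' P5) (fun j => ⟨j.val + 1, by omega⟩) 5 where
  hm := by norm_num
  hn := by norm_num
  symm := by decide +kernel
  geo := fun b => ⟨by revert b; decide +kernel, by revert b; decide +kernel,
    by revert b; decide +kernel⟩
  dsum := by decide +kernel
  cyc_inj := by decide +kernel
  cyc_ne := by decide +kernel
  cyc_adj := by decide +kernel
  bridge := by decide +kernel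
  kinds := by decide +kernel
  pc0 := by decide +kernel
  v_ne := by decide +kernel
  symm' := by decide +kernel
  z' := by decide +kernel
  geo' := ⟨by decide +kernel, by decide +kernel, by decide +kernel⟩
  row' := by decide +kernel
  tot' := by decide +kernel
  root' := by decide +kernel

theorem data6 : Data 23 5 D6 (tab 24 K6' P6) (fun j => ⟨j.val + 1, by omega⟩) 6 where
  hm := by norm_num
  hn := by norm_num
  symm := by decide +kernel
  geo := fun b => ⟨by revert b; decide +kernel, by revert b; decide +kernel,
    by revert b; decide +kernel⟩
  dsum := by decide +kernel
  cyc_inj := by decide +kernel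
  cyc_ne := by decide +kernel
  cyc_adj := by decide +kernel
  bridge := by decide +kernel
  kinds := by decide +kernel
  pc0 := by decide +kernel
  v_ne := by decide +kernel
  symm' := by decide +kernel
  z' := by decide +kernel
  geo' := ⟨by decide +kernel, by decide +kernel, by decide +kernel⟩
  row' := by decide +kernel
  tot' := by decide +kernel
  root' := by decide +kernel

/-- For every `k ≥ 1` and `c ∈ {5, 6}` there are arbitrarily large connected cactus graphs
with exactly `k` cycles, all of length `c`, having exactly `k` good vertices. -/
theorem exists_large_cactus_with_exactly_k_good_vertices (k c N : ℕ)
    (hk : 1 ≤ k) (hc : c = 5 ∨ c = 6) :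
    ∃ (V : Type) (_ : Fintype V) (_ : DecidableEq V) (G : SimpleGraph V),
      G.Connected ∧ N < Fintype.card V ∧
      -- G is a cactus: every edge lies on at most one cycle (cycles through a common
      -- edge have the same edge-set)
      (∀ (u₁ : V) (w₁ : G.Walk u₁ u₁), w₁.IsCycle →
        ∀ (u₂ : V) (w₂ : G.Walk u₂ u₂), w₂.IsCycle →
          ∀ e : Sym2 V, e ∈ w₁.edges → e ∈ w₂.edges →
            ∀ e' : Sym2 V, e' ∈ w₁.edges ↔ e' ∈ w₂.edges) ∧
      -- G has exactly k cycles (k distinct edge-sets of cycles)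
      {s : Set (Sym2 V) | ∃ (u : V) (w : G.Walk u u), w.IsCycle ∧ s = {e | e ∈ w.edges}}.ncard
        = k ∧
      -- every cycle of G has length c
      (∀ (u : V) (w : G.Walk u u), w.IsCycle → w.length = c) ∧
      -- G has exactly k good vertices
      {v : V | good G v}.ncard = k := by
  rcases hc with rfl | rfl
  · exact main_of_data data5 k N
  · exact main_of_data data6 k N
end
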